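/- arXiv:math/0507125 — 4 statements merged into one kernel-verified Lean document; each statement's English description precedes it below -/
import Mathlib

section
/- For every 2-cocycle σ ∈ Z²(G,kˣ), the map θ(σ) : G → kˣ defined by θ(σ)(g) = σ(g,u)σ(u,g)⁻¹ is a group homomorphism whose values lie in {1,−1} and which satisfies θ(σ)(u) = 1; moreover the assignment σ ↦ θ(σ) is a group homomorphism from Z²(G,kˣ) (with pointwise product) to Hom(G,{1,−1}) which sends every 2-coboundary ∂γ to the trivial homomorphism. -/
variable (k : Type*) [Field k] (G : Type*) [Group G]

/-- A normalized 2-cocycle on `G` with values in `kˣ` (trivial `G`-action):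
`σ(g,h)σ(gh,l) = σ(h,l)σ(g,hl)` and `σ(1,g) = σ(g,1) = 1`. -/
def IsCocycle (σ : G → G → kˣ) : Prop :=
  (∀ g h l : G, σ g h * σ (g * h) l = σ h l * σ g (h * l)) ∧
    (∀ g : G, σ 1 g = 1) ∧ (∀ g : G, σ g 1 = 1)

/-- The map `θ(σ) : g ↦ σ(g,u)σ(u,g)⁻¹`. -/
def theta (u : G) (σ : G → G → kˣ) : G → kˣ := fun g => σ g u * (σ u g)⁻¹

/-- For every 2-cocycle `σ ∈ Z²(G,kˣ)`, the map `θ(σ)(g) = σ(g,u)σ(u,g)⁻¹` is a group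
homomorphism with values in `{1,-1}` satisfying `θ(σ)(u) = 1`; moreover `σ ↦ θ(σ)` is a
group homomorphism from `Z²(G,kˣ)` (pointwise product) to `Hom(G,{1,-1})` killing
2-coboundaries. -/
theorem statement0 [Finite G] (u : G) (hcen : ∀ g : G, u * g = g * u) (hu : u ^ 2 = 1) :
    (∀ σ : G → G → kˣ, IsCocycle k G σ →
        (∀ g h : G, theta k G u σ (g * h) = theta k G u σ g * theta k G u σ h) ∧
        (∀ g : G, theta k G u σ g = 1 ∨ theta k G u σ g = -1) ∧
        theta k G u σ u = 1) ∧
    (∀ σ ω : G → G → kˣ, IsCocycle k G σ → IsCocycle k G ω →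
        ∀ g : G, theta k G u (σ * ω) g = theta k G u σ g * theta k G u ω g) ∧
    (∀ γ : G → kˣ, γ 1 = 1 →
        ∀ g : G, theta k G u (fun a b => γ a * γ b * (γ (a * b))⁻¹) g = 1) := by
  refine ⟨fun σ ⟨hc, _, h1⟩ => ⟨fun g h => ?_, fun g => ?_, ?_⟩, fun σ ω _ _ g => ?_, fun γ _ g => ?_⟩
  · have A := hc g h u
    have B := hc g u h
    have C := hc u g h
    rw [hcen h] at B
    rw [hcen g] at C
    simp only [theta]
    have A' : σ (g * h) u = (σ g h)⁻¹ * (σ h u * σ g (h * u)) := by rw [← A]; group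
    have B' : σ g (h * u) = (σ u h)⁻¹ * (σ g u * σ (g * u) h) := by rw [B]; group
    have C' : σ u (g * h) = (σ g h)⁻¹ * (σ u g * σ (g * u) h) := by rw [C]; group
    rw [A', C', B']
    apply Units.ext
    push_cast
    field_simp
  · have huu : u * u = 1 := by rw [← pow_two, hu]
    have A := hc g u u
    have B := hc u u g
    have C := hc u g u
    rw [huu, h1, mul_one] at A
    rw [huu, hcen g, (by assumption : ∀ g : G, σ 1 g = 1), mul_one] at B
    rw [hcen g] at C
    have key : σ g u * σ g u = σ u g * σ u g := by
      apply mul_right_cancel (b := σ u (g * u))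
      calc σ g u * σ g u * σ u (g * u) = σ g u * (σ g u * σ u (g * u)) := mul_assoc _ _ _
        _ = σ u g * (σ g u * σ (g * u) u) := by rw [← C]; exact mul_left_comm _ _ _
        _ = σ u g * σ u g * σ u (g * u) := by rw [A, B, mul_left_comm, mul_assoc]
    have key' : (σ g u : k) = σ u g ∨ (σ g u : k) = -σ u g :=
      mul_self_eq_mul_self_iff.mp (by exact_mod_cast congrArg Units.val key)
    simp only [theta, mul_inv_eq_iff_eq_mul]
    rcases key' with h | h
    · left; apply Units.ext; simpa using h
    · right; apply Units.ext; simpa using h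
  · simp [theta]
  · simp only [theta, Pi.mul_apply, mul_inv]
    exact mul_mul_mul_comm _ _ _ _
  · simp only [theta, hcen g, mul_comm (γ u) (γ g), mul_inv_cancel]
end

section
/- For all 2-cocycles σ, ω ∈ Z²(G,kˣ), the sharp product σ♯ω is again a 2-cocycle on G with values in kˣ. -/
variable (k : Type*) [Field k] (G : Type*) [Group G]

open Classical in
/-- The degree `|g|_σ ∈ {0,1}` determined by `θ(σ)(g) = σ(g,u)σ(u,g)⁻¹ = (-1)^{|g|_σ}`. -/
noncomputable def deg (u : G) (σ : G → G → kˣ) (g : G) : ℕ :=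
  if σ g u = σ u g then 0 else 1

/-- The sharp product `(σ♯ω)(g,h) = σ(g,h)ω(g,h)(-1)^{|g|_σ |h|_ω}`. -/
noncomputable def sharpFun (u : G) (σ ω : G → G → kˣ) : G → G → kˣ :=
  fun g h => σ g h * ω g h * (-1 : kˣ) ^ (deg k G u σ g * deg k G u ω h)

/-- The candidate ♯-inverse `σ'(g,h) = σ(g,h)⁻¹ (-1)^{|g|_σ |h|_σ}`. -/
noncomputable def sharpInvFun (u : G) (σ : G → G → kˣ) : G → G → kˣ :=
  fun g h => (σ g h)⁻¹ * (-1 : kˣ) ^ (deg k G u σ g * deg k G u σ h)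

theorem theta_mul (u : G) (hcen : ∀ g : G, u * g = g * u)
    (σ : G → G → kˣ) (hσ : IsCocycle k G σ) (g h : G) :
    σ (g * h) u * (σ u (g * h))⁻¹ = σ g u * (σ u g)⁻¹ * (σ h u * (σ u h)⁻¹) := by
  obtain ⟨hc, -, -⟩ := hσ
  have h1 := hc g h u
  have h2 := hc g u h
  have h3 := hc u g h
  rw [← hcen h] at h1
  rw [← hcen g] at h2
  have e1 : σ (g * h) u = (σ g h)⁻¹ * (σ h u * σ g (u * h)) := by rw [← h1]; group
  have e2 : σ g (u * h) = (σ u h)⁻¹ * (σ g u * σ (u * g) h) := by rw [h2]; group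
  have e3 : σ u (g * h) = (σ g h)⁻¹ * (σ u g * σ (u * g) h) := by rw [h3]; group
  rw [e1, e2, e3]
  ext
  push_cast
  field_simp

theorem theta_eq (u : G) (hcen : ∀ g : G, u * g = g * u) (hu : u ^ 2 = 1)
    (σ : G → G → kˣ) (hσ : IsCocycle k G σ) (g : G) :
    (-1 : kˣ) ^ deg k G u σ g = σ g u * (σ u g)⁻¹ := by
  obtain ⟨hc, hl, hr⟩ := hσ
  unfold deg
  split_ifs with h
  · simp [h]
  · have h1 := hc g u u
    have h2 := hc u u g
    have h3 := hc u g u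
    rw [← pow_two, hu, hr, mul_one] at h1
    rw [← pow_two, hu, hl, mul_one] at h2
    rw [← hcen g] at h1 h3
    have e : (σ g u) ^ 2 = (σ u g) ^ 2 := by
      have a1 : σ g u * σ (u * g) u = σ u g * σ u (u * g) := by rw [h1, h2]
      have : (σ g u) ^ 2 * (σ (u * g) u * σ u (u * g))
          = (σ u g) ^ 2 * (σ (u * g) u * σ u (u * g)) := by
        calc _ = (σ g u * σ (u * g) u) * (σ g u * σ u (u * g)) := by
              rw [pow_two]; ac_rfl
          _ = (σ u g * σ u (u * g)) * (σ u g * σ (u * g) u) := by rw [a1, h3]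
          _ = _ := by rw [pow_two]; ac_rfl
      exact mul_right_cancel this
    rcases sq_eq_sq_iff_eq_or_eq_neg.mp (congrArg Units.val e) with h' | h'
    · exact absurd (Units.ext h') h
    · have : σ g u = -σ u g := Units.ext h'
      simp [this]

theorem degsign_mul (u : G) (hcen : ∀ g : G, u * g = g * u) (hu : u ^ 2 = 1)
    (σ : G → G → kˣ) (hσ : IsCocycle k G σ) (g h : G) :
    (-1 : kˣ) ^ deg k G u σ (g * h) = (-1 : kˣ) ^ deg k G u σ g * (-1 : kˣ) ^ deg k G u σ h := by
  rw [theta_eq k G u hcen hu σ hσ, theta_eq k G u hcen hu σ hσ, theta_eq k G u hcen hu σ hσ,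
    theta_mul k G u hcen σ hσ]

/-- For all 2-cocycles `σ, ω ∈ Z²(G,kˣ)`, the sharp product `σ♯ω` is again a 2-cocycle. -/
theorem statement1 [Finite G] (u : G) (hcen : ∀ g : G, u * g = g * u) (hu : u ^ 2 = 1)
    (σ ω : G → G → kˣ) (hσ : IsCocycle k G σ) (hω : IsCocycle k G ω) :
    IsCocycle k G (sharpFun k G u σ ω) := by
  have d1 : ∀ τ : G → G → kˣ, IsCocycle k G τ → deg k G u τ 1 = 0 := by
    rintro τ ⟨-, hl, hr⟩
    simp [deg, hl, hr]
  refine ⟨fun g h l => ?_, fun g => ?_, fun g => ?_⟩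
  · have s1 : (-1 : kˣ) ^ (deg k G u σ (g * h) * deg k G u ω l) =
        (-1 : kˣ) ^ (deg k G u σ g * deg k G u ω l) *
          (-1 : kˣ) ^ (deg k G u σ h * deg k G u ω l) := by
      rw [pow_mul, degsign_mul k G u hcen hu σ hσ, mul_pow, ← pow_mul, ← pow_mul]
    have s2 : (-1 : kˣ) ^ (deg k G u σ g * deg k G u ω (h * l)) =
        (-1 : kˣ) ^ (deg k G u σ g * deg k G u ω h) *
          (-1 : kˣ) ^ (deg k G u σ g * deg k G u ω l) := by
      rw [pow_mul', degsign_mul k G u hcen hu ω hω, mul_pow, ← pow_mul', ← pow_mul']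
    simp only [sharpFun]
    rw [s1, s2]
    generalize (-1 : kˣ) ^ (deg k G u σ g * deg k G u ω h) = x
    generalize (-1 : kˣ) ^ (deg k G u σ g * deg k G u ω l) = y
    generalize (-1 : kˣ) ^ (deg k G u σ h * deg k G u ω l) = z
    calc _ = (σ g h * σ (g * h) l) * (ω g h * ω (g * h) l) * (x * y * z) := by ac_rfl
      _ = (σ h l * σ g (h * l)) * (ω h l * ω g (h * l)) * (x * y * z) := by
        rw [hσ.1, hω.1]
      _ = _ := by ac_rfl
  · simp [sharpFun, d1 σ hσ, hσ.2.1, hω.2.1]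
  · simp [sharpFun, d1 ω hω, hσ.2.2, hω.2.2]
end

section
/- Let G = ℤ/2 × ℤ/2 with generators x, y and central element u = x. The map λ(x^t y^s, x^l y^m) = (−1)^{tm} (for t,s,l,m ∈ {0,1}) is a well-defined 2-cocycle on G with values in kˣ; its associated degree satisfies |x^l y^m|_λ = m; and its sharp square satisfies (λ♯λ)(x^t y^s, x^l y^m) = (−1)^{sm} for all t,s,l,m ∈ {0,1}. -/
variable (k : Type*) [Field k] (G : Type*) [Group G]

/-- The Klein four group `ℤ/2 × ℤ/2`, written multiplicatively. -/
abbrev V4 := Multiplicative (ZMod 2 × ZMod 2)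

/-- The generator `x` of the first factor; it is the distinguished central element `u`. -/
def xg : V4 := Multiplicative.ofAdd (1, 0)

/-- The generator `y` of the second factor. -/
def yg : V4 := Multiplicative.ofAdd (0, 1)

/-- The cocycle `λ(x^t y^s, x^l y^m) = (-1)^{tm}` on `ℤ/2 × ℤ/2`. -/
def lam : V4 → V4 → kˣ :=
  fun a b => (-1 : kˣ) ^ ((Multiplicative.toAdd a).1.val * (Multiplicative.toAdd b).2.val)

/-- `(-1)^n` in an abelian group with a sign depends only on the parity of `n`. -/
theorem neg_one_pow_of_mod (k : Type*) [Field k] {a b : ℕ} (h : a % 2 = b % 2) :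
    (-1 : kˣ) ^ a = (-1 : kˣ) ^ b := by
  rw [← Nat.div_add_mod a 2, ← Nat.div_add_mod b 2, h]
  simp [pow_add, pow_mul]

theorem lam_isCocycle (k : Type*) [Field k] : IsCocycle k V4 (lam k) := by
  refine ⟨fun g h l => ?_, fun g => ?_, fun g => ?_⟩
  · unfold lam
    rw [← pow_add, ← pow_add]
    apply neg_one_pow_of_mod
    simp only [toAdd_mul, Prod.fst_add, Prod.snd_add]
    generalize (Multiplicative.toAdd g).1 = a
    generalize (Multiplicative.toAdd h).1 = b
    generalize (Multiplicative.toAdd h).2 = c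
    generalize (Multiplicative.toAdd l).2 = d
    revert a b c d
    decide
  · simp [lam]
  · simp [lam]

theorem coord_fst (t s : ℕ) (ht : t ≤ 1) :
    (Multiplicative.toAdd (xg ^ t * yg ^ s)).1.val = t := by
  simp [xg, yg, ZMod.val_natCast]
  omega

theorem coord_snd (t s : ℕ) (hs : s ≤ 1) :
    (Multiplicative.toAdd (xg ^ t * yg ^ s)).2.val = s := by
  simp [xg, yg, ZMod.val_natCast]
  omega

theorem lam_deg (k : Type*) [Field k] (hk : (-1 : k) ≠ 1) (l m : ℕ) (hm : m ≤ 1) :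
    deg k V4 xg (lam k) (xg ^ l * yg ^ m) = m := by
  have hk' : (-1 : kˣ) ≠ 1 := fun h => hk (by simpa using congrArg Units.val h)
  have h1 : lam k (xg ^ l * yg ^ m) xg = 1 := by simp [lam, xg]
  have h2 : lam k xg (xg ^ l * yg ^ m) = (-1) ^ m := by
    unfold lam
    rw [coord_snd l m hm]
    simp [xg, ZMod.val_one]
  unfold deg
  rw [h1, h2]
  interval_cases m
  · simp
  · simp [hk'.symm]

/-- On `G = ℤ/2 × ℤ/2` with `u = x`: `λ(x^t y^s, x^l y^m) = (-1)^{tm}` is a well-defined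
2-cocycle, its degree satisfies `|x^l y^m|_λ = m`, and `(λ♯λ)(x^t y^s, x^l y^m) = (-1)^{sm}`. -/
theorem statement8 (hk : (-1 : k) ≠ 1) :
    IsCocycle k V4 (lam k) ∧
    (∀ t s l m : ℕ, t ≤ 1 → s ≤ 1 → l ≤ 1 → m ≤ 1 →
        lam k (xg ^ t * yg ^ s) (xg ^ l * yg ^ m) = (-1 : kˣ) ^ (t * m)) ∧
    (∀ l m : ℕ, l ≤ 1 → m ≤ 1 → deg k V4 xg (lam k) (xg ^ l * yg ^ m) = m) ∧
    (∀ t s l m : ℕ, t ≤ 1 → s ≤ 1 → l ≤ 1 → m ≤ 1 →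
        sharpFun k V4 xg (lam k) (lam k) (xg ^ t * yg ^ s) (xg ^ l * yg ^ m) =
          (-1 : kˣ) ^ (s * m)) := by
  have hlam : ∀ t s l m : ℕ, t ≤ 1 → s ≤ 1 → l ≤ 1 → m ≤ 1 →
      lam k (xg ^ t * yg ^ s) (xg ^ l * yg ^ m) = (-1 : kˣ) ^ (t * m) := by
    intro t s l m ht _ _ hm
    unfold lam
    rw [coord_fst t s ht, coord_snd l m hm]
  refine ⟨lam_isCocycle k, hlam, fun l m _ hm => lam_deg k hk l m hm, ?_⟩
  intro t s l m ht hs hl hm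
  unfold sharpFun
  rw [hlam t s l m ht hs hl hm, lam_deg k hk t s hs, lam_deg k hk l m hm, ← pow_add, ← pow_add]
  apply neg_one_pow_of_mod
  omega
end

section
/- Let m ≥ 2, let W be the Coxeter group of type B_{2m} on generators s₁,…,s_{2m}, and let u = (s₁s₂⋯s_{2m})^{2m} be its longest element, a central involution. Then H²(W/⟨u⟩, ℂˣ) is isomorphic to ℤ/2 × ℤ/2 × ℤ/2. -/
variable (k : Type*) [Field k] (G : Type*) [Group G]

/-- A 2-coboundary: `∂γ(g,h) = γ(g)γ(h)γ(gh)⁻¹` for some `γ` with `γ(1) = 1`. -/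
def IsCoboundary (σ : G → G → kˣ) : Prop :=
  ∃ γ : G → kˣ, γ 1 = 1 ∧ ∀ g h : G, σ g h = γ g * γ h * (γ (g * h))⁻¹

/-- The group `Z²(G,kˣ)` of 2-cocycles, as a subgroup of the pointwise product group. -/
def Z2 : Subgroup (G → G → kˣ) where
  carrier := {σ | IsCocycle k G σ}
  one_mem' := ⟨fun _ _ _ => by simp, fun _ => rfl, fun _ => rfl⟩
  mul_mem' := by
    rintro σ ω ⟨hσ1, hσ2, hσ3⟩ ⟨hω1, hω2, hω3⟩
    refine ⟨fun g h l => ?_, fun g => ?_, fun g => ?_⟩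
    · simp only [Pi.mul_apply]
      rw [mul_mul_mul_comm, hσ1 g h l, hω1 g h l, mul_mul_mul_comm]
    · simp only [Pi.mul_apply, hσ2 g, hω2 g, one_mul]
    · simp only [Pi.mul_apply, hσ3 g, hω3 g, one_mul]
  inv_mem' := by
    rintro σ ⟨h1, h2, h3⟩
    refine ⟨fun g h l => ?_, fun g => ?_, fun g => ?_⟩
    · simp only [Pi.inv_apply]
      rw [← mul_inv, ← mul_inv, h1 g h l]
    · simp only [Pi.inv_apply, h2 g, inv_one]
    · simp only [Pi.inv_apply, h3 g, inv_one]

/-- The subgroup `B²(G,kˣ)` of 2-coboundaries inside `Z²(G,kˣ)`. -/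
def B2 : Subgroup (Z2 k G) where
  carrier := {σ | IsCoboundary k G (σ : G → G → kˣ)}
  one_mem' := ⟨fun _ => 1, rfl, fun g h => by simp⟩
  mul_mem' := by
    rintro σ ω ⟨γ, hγ1, hγ⟩ ⟨δ, hδ1, hδ⟩
    refine ⟨γ * δ, by simp [hγ1, hδ1], fun g h => ?_⟩
    show (σ : G → G → kˣ) g h * (ω : G → G → kˣ) g h = _
    rw [hγ g h, hδ g h]
    simp only [Pi.mul_apply, mul_inv]
    ac_rfl
  inv_mem' := by
    rintro σ ⟨γ, hγ1, hγ⟩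
    refine ⟨γ⁻¹, by simp [hγ1], fun g h => ?_⟩
    show ((σ : G → G → kˣ) g h)⁻¹ = _
    rw [hγ g h]
    simp only [Pi.inv_apply, mul_inv, inv_inv]

/-- The second cohomology group `H²(G,kˣ) = Z²(G,kˣ)/B²(G,kˣ)` with its usual
(pointwise-multiplication-induced) group structure. -/
abbrev H2 := Z2 k G ⧸ B2 k G

/-- The relations `(sᵢsⱼ)^{m i j} = 1` of a Coxeter presentation (with `m i i = 1`,
so that the generators are involutions). -/
def coxeterRels {n : ℕ} (m : Fin n → Fin n → ℕ) : Set (FreeGroup (Fin n)) :=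
  ⋃ (i : Fin n) (j : Fin n), {(FreeGroup.of i * FreeGroup.of j) ^ m i j}

/-- The Coxeter group presented by the matrix `m`. -/
abbrev CoxGroup {n : ℕ} (m : Fin n → Fin n → ℕ) := PresentedGroup (coxeterRels m)

/-- The simple reflections. -/
def coxS {n : ℕ} (m : Fin n → Fin n → ℕ) (i : Fin n) : CoxGroup m := PresentedGroup.of i

/-- The Coxeter element `s₁ s₂ ⋯ sₙ`. -/
def coxProd {n : ℕ} (m : Fin n → Fin n → ℕ) : CoxGroup m :=
  (List.ofFn fun i => coxS m i).prod

/-- The Coxeter matrix of type `Bₙ` (0-indexed; `(s_{n-1}sₙ)⁴ = 1`). -/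
def mB (n : ℕ) : Fin n → Fin n → ℕ := fun i j =>
  if i = j then 1
  else if i.val + 1 = j.val ∨ j.val + 1 = i.val then
    (if i.val + j.val + 3 = 2 * n then 4 else 3)
  else 2


def pr {E : Type*} [Group E] (S : ℕ → E) (a k : ℕ) : E := ((List.range' a k).map S).prod

section
variable {E : Type*} [Group E]

lemma pr_zero (S : ℕ → E) (a : ℕ) : pr S a 0 = 1 := by simp [pr]

lemma pr_succ_left (S : ℕ → E) (a k : ℕ) : pr S a (k+1) = S a * pr S (a+1) k := by
  simp [pr, List.range'_succ]

lemma pr_add (S : ℕ → E) (a j k : ℕ) : pr S a (j+k) = pr S a j * pr S (a+j) k := by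
  unfold pr
  rw [← List.prod_append, ← List.map_append, List.range'_append_1]

lemma pr_one (S : ℕ → E) (a : ℕ) : pr S a 1 = S a := by simp [pr]

lemma pr_succ (S : ℕ → E) (a k : ℕ) : pr S a (k+1) = pr S a k * S (a+k) := by
  rw [pr_add, pr_one]

lemma map_pr {E' : Type*} [Group E'] (f : E →* E') (S : ℕ → E) (a k : ℕ) :
    f (pr S a k) = pr (fun i => f (S i)) a k := by
  simp [pr, map_list_prod, Function.comp_def]

lemma pr_congr (S S' : ℕ → E) (a k : ℕ) (h : ∀ i, a ≤ i → i < a + k → S i = S' i) :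
    pr S a k = pr S' a k := by
  unfold pr
  congr 1
  apply List.map_congr_left
  intro i hi
  rw [List.mem_range'_1] at hi
  exact h i hi.1 hi.2

structure CRel (M : ℕ) (S : ℕ → E) (α β γ : E) : Prop where
  cα : ∀ x, α * x = x * α
  cβ : ∀ x, β * x = x * β
  cγ : ∀ x, γ * x = x * γ
  α2 : α * α = 1
  β2 : β * β = 1
  sq : ∀ i, S i * S i = 1
  braid : ∀ i, i < M → S i * S (i+1) * S i = S (i+1) * S i * S (i+1)
  commA : ∀ i j, i + 2 ≤ j → j ≤ M → S i * S j = α * (S j * S i)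
  commB : ∀ i, i < M → S i * S (M+1) = β * (S (M+1) * S i)
  four : (S M * S (M+1))^4 = γ

lemma pow_even_one {z : E} (hz : z * z = 1) {n : ℕ} (hn : Even n) : z ^ n = 1 := by
  obtain ⟨k, rfl⟩ := hn
  rw [← two_mul, pow_mul, pow_two, hz, one_pow]

lemma central_pow {z : E} (hz : ∀ x, z * x = x * z) (n : ℕ) : ∀ x, z ^ n * x = x * z ^ n := by
  intro x
  have : Commute z x := hz x
  exact (this.pow_left n)

/-- moving an element through a product -/
lemma pr_move (S : ℕ → E) (z y : E) (hz : ∀ x, z * x = x * z) (a k : ℕ)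
    (h : ∀ i, a ≤ i → i < a + k → S i * y = z * (y * S i)) :
    pr S a k * y = z ^ k * (y * pr S a k) := by
  induction k with
  | zero => simp [pr_zero]
  | succ k ih =>
    rw [pr_succ, mul_assoc, h _ (by omega) (by omega), ← mul_assoc, ← hz, mul_assoc,
      ← mul_assoc (pr S a k), ih (fun i h1 h2 => h i h1 (by omega)), pow_succ']
    simp only [mul_assoc]

lemma pr_shift (S : ℕ → E) (z y : E) (hz : ∀ x, z * x = x * z) (a k : ℕ)
    (h : ∀ i, a ≤ i → i < a + k → y * S i = z * (S (i+1) * y)) :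
    y * pr S a k = z ^ k * (pr S (a+1) k * y) := by
  induction k with
  | zero => simp [pr_zero]
  | succ k ih =>
    rw [pr_succ, ← mul_assoc, ih (fun i h1 h2 => h i h1 (by omega)), mul_assoc, mul_assoc,
      h _ (by omega) (by omega), ← mul_assoc (pr S (a+1) k), ← hz, pow_succ, pr_succ,
      show a + 1 + k = a + k + 1 by ring]
    simp only [mul_assoc]

namespace CRel
variable {M : ℕ} {S : ℕ → E} {α β γ : E}

lemma commA' (h : CRel M S α β γ) (i j : ℕ) (h1 : i + 2 ≤ j) (h2 : j ≤ M) :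
    S j * S i = α * (S i * S j) := by
  rw [h.commA i j h1 h2, ← mul_assoc α α, h.α2, one_mul]

lemma commB' (h : CRel M S α β γ) (i : ℕ) (h1 : i < M) :
    S (M+1) * S i = β * (S i * S (M+1)) := by
  rw [h.commB i h1, ← mul_assoc β β, h.β2, one_mul]

lemma D_conj (h : CRel M S α β γ) (i j : ℕ) (hij : i < j) (hj : j ≤ M) :
    pr S 0 (j+1) * S i = α ^ (j-1) * (S (i+1) * pr S 0 (j+1)) := by
  obtain ⟨l, rfl⟩ : ∃ l, j = i + 1 + l := ⟨j - (i+1), by omega⟩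
  have e1 : pr S 0 (i+1+l+1) = pr S 0 i * (S i * S (i+1)) * pr S (i+2) l := by
    rw [show i+1+l+1 = i + (1 + 1 + l) by ring, pr_add, pr_add, pr_add, pr_one, pr_one]
    simp [mul_assoc]
  have m1 : pr S (i+2) l * S i = α ^ l * (S i * pr S (i+2) l) :=
    pr_move S α (S i) h.cα _ _ (fun t h1 h2 => h.commA' i t h1 (by omega))
  have m2 : pr S 0 i * S (i+1) = α ^ i * (S (i+1) * pr S 0 i) :=
    pr_move S α (S (i+1)) h.cα _ _ (fun t h1 h2 => h.commA t (i+1) (by omega) (by omega))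
  have b := h.braid i (by omega)
  rw [e1]
  calc pr S 0 i * (S i * S (i+1)) * pr S (i+2) l * S i
      = pr S 0 i * (S i * S (i+1)) * (α ^ l * (S i * pr S (i+2) l)) := by rw [mul_assoc _ _ (S i), m1]
    _ = α ^ l * (pr S 0 i * (S i * S (i+1) * S i) * pr S (i+2) l) := by
        rw [← mul_assoc _ (α^l), ← central_pow h.cα]; simp only [mul_assoc]
    _ = α ^ l * (pr S 0 i * S (i+1) * (S i * S (i+1)) * pr S (i+2) l) := by
        rw [b]; simp only [mul_assoc]
    _ = _ := by
        rw [m2, show i + 1 + l - 1 = l + i by omega, pow_add]; simp only [mul_assoc]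

lemma c_conj (h : CRel M S α β γ) (i : ℕ) (hi : i < M) :
    pr S 0 (M+2) * S i = (β * α ^ (M-1)) * (S (i+1) * pr S 0 (M+2)) := by
  rw [pr_succ S 0 (M+1), zero_add, mul_assoc, h.commB' i hi, ← mul_assoc, ← h.cβ, mul_assoc,
    ← mul_assoc _ (S i), h.D_conj i M hi le_rfl]
  simp only [mul_assoc]

lemma cω (h : CRel M S α β γ) (x : E) : (β * α ^ (M-1)) * x = x * (β * α ^ (M-1)) := by
  rw [mul_assoc, central_pow h.cα, ← mul_assoc, h.cβ, mul_assoc]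

lemma ω2 (h : CRel M S α β γ) : (β * α ^ (M-1)) * (β * α ^ (M-1)) = 1 := by
  rw [mul_assoc, ← mul_assoc _ β, ← h.cβ, mul_assoc, ← pow_add, ← mul_assoc, h.β2, one_mul,
    pow_even_one h.α2 ⟨_, rfl⟩]

lemma cpow_conj (h : CRel M S α β γ) (i j : ℕ) (hi : i + j ≤ M) :
    pr S 0 (M+2) ^ j * S i = (β * α ^ (M-1)) ^ j * (S (i+j) * pr S 0 (M+2) ^ j) := by
  induction j with
  | zero => simp
  | succ j ih =>
    rw [pow_succ', mul_assoc, ih (by omega), ← mul_assoc, ← central_pow h.cω, mul_assoc,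
      ← mul_assoc _ (S (i+j)), h.c_conj (i+j) (by omega), pow_succ (β * _)]
    simp only [mul_assoc, add_assoc]

lemma c_two (h : CRel M S α β γ) (hM : Even M) :
    pr S 0 (M+2) * pr S 0 (M+2) * S M = γ * (S 0 * (pr S 0 (M+2) * pr S 0 (M+2))) := by
  set p := pr S 0 M with hp
  set X := S M with hX
  set Y := S (M+1) with hY
  set D := pr S 0 (M+1) with hD
  have eD : D = p * X := by rw [hD, pr_succ, zero_add]
  have ec : pr S 0 (M+2) = D * Y := by rw [pr_succ S 0 (M+1), zero_add]
  have hYp : p * Y = Y * p := by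
    rw [hp, pr_move S β Y h.cβ 0 M (fun i _ h2 => h.commB i (by omega)), pow_even_one h.β2 hM,
      one_mul]
  have hDp : D * p = S 0 * D * D := by
    rw [hp, pr_shift S (α ^ (M-1)) D (central_pow h.cα _) 0 M
      (fun i _ h2 => h.D_conj i M (by omega) le_rfl), ← pow_mul,
      pow_even_one h.α2 (hM.mul_left _), one_mul]
    congr 1
    rw [hD, pr_succ_left, ← mul_assoc, h.sq, one_mul]
  have f := h.four
  have f2 : X * Y * X * Y * X = γ * (Y * X * Y) := by
    have f' : (X * Y) ^ 4 = γ := f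
    rw [← f']
    have hx : X * X = 1 := h.sq _
    have hy : Y * Y = 1 := h.sq _
    have hx' : X⁻¹ = X := inv_eq_of_mul_eq_one_left hx
    have hy' : Y⁻¹ = Y := inv_eq_of_mul_eq_one_left hy
    have : Y * X * Y = (Y * X * Y)⁻¹ := by simp [mul_assoc, hx', hy']
    rw [this]
    simp only [pow_succ, pow_zero, one_mul]
    group

  rw [ec]
  calc D * Y * (D * Y) * X = D * (Y * p) * X * Y * X := by rw [eD]; simp only [mul_assoc]
    _ = (D * p) * Y * X * Y * X := by rw [← hYp]; simp only [mul_assoc]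
    _ = S 0 * D * p * (X * Y * X * Y * X) := by rw [hDp]; nth_rewrite 2 [eD]; simp only [mul_assoc]
    _ = γ * (S 0 * D * (p * Y) * X * Y) := by
      rw [f2, ← mul_assoc, ← h.cγ]; simp only [mul_assoc]
    _ = _ := by rw [hYp, eD]; simp only [mul_assoc]

lemma c_all (h : CRel M S α β γ) (hM : Even M) :
    pr S 0 (M+2) ^ (M+2) * S 0 = γ * (S 0 * pr S 0 (M+2) ^ (M+2)) := by
  have h1 := h.cpow_conj 0 M (by omega)
  rw [pow_even_one h.ω2 hM, one_mul, zero_add] at h1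
  rw [add_comm M 2, pow_add, mul_assoc]
  rw [add_comm 2 M, h1, pow_two, ← mul_assoc, h.c_two hM]
  simp only [mul_assoc]

lemma c_central (h : CRel M S α β 1) (hM : Even M) (i : ℕ) (hi : i < M + 2) :
    Commute (pr S 0 (M+2) ^ (M+2)) (S i) := by
  set c := pr S 0 (M+2) with hc
  have key : ∀ i, i ≤ M → Commute (c ^ (M+2)) (S i) := by
    intro i
    induction i with
    | zero => intro _; have := h.c_all hM; rw [one_mul] at this; exact this
    | succ i ih =>
      intro hi
      have e := h.c_conj i (by omega)
      have : S (i+1) = (β * α ^ (M-1)) * (c * S i * c⁻¹) := by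
        rw [e, ← mul_assoc, ← mul_assoc, ← mul_assoc, h.ω2, one_mul, mul_inv_cancel_right]
      rw [this]
      apply Commute.mul_right
      · exact (h.cω _).symm
      · have cc : Commute (c ^ (M+2)) c := (Commute.refl c).pow_left _
        exact (cc.mul_right (ih (by omega))).mul_right cc.inv_right
  rcases Nat.lt_or_ge i (M+1) with h1 | h1
  · exact key i (by omega)
  · obtain rfl : i = M + 1 := by omega
    have : S (M+1) = (pr S 0 (M+1))⁻¹ * c := by
      rw [hc, pr_succ S 0 (M+1), zero_add, inv_mul_cancel_left]
    rw [this]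
    apply Commute.mul_right
    · apply Commute.inv_right
      have : ∀ k, k ≤ M + 1 → Commute (c ^ (M+2)) (pr S 0 k) := by
        intro k
        induction k with
        | zero => intro _; rw [pr_zero]; exact Commute.one_right _
        | succ k ih => intro hk; rw [pr_succ]; exact (ih (by omega)).mul_right (key _ (by omega))
      exact this _ le_rfl
    · exact (Commute.refl c).pow_left _

/-- commutation up to a central sign -/
def SC (x y : E) : Prop := ∃ z : E, (∀ w, z * w = w * z) ∧ z * z = 1 ∧ x * y = z * (y * x)

lemma SC.mul_left {x x' y : E} (h : SC x y) (h' : SC x' y) : SC (x * x') y := by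
  obtain ⟨z, hz, z2, e⟩ := h
  obtain ⟨z', hz', z2', e'⟩ := h'
  refine ⟨z * z', ?_, ?_, ?_⟩
  · intro w; rw [mul_assoc, hz', ← mul_assoc, hz, mul_assoc]
  · rw [mul_assoc, ← mul_assoc z', hz' z, mul_assoc, z2', mul_one, z2]
  · rw [mul_assoc, e', ← mul_assoc, ← hz', mul_assoc, ← mul_assoc x, e, ← mul_assoc, ← mul_assoc, ← mul_assoc,
      hz' z]
    simp only [mul_assoc]

lemma SC.symm {x y : E} (h : SC x y) : SC y x := by
  obtain ⟨z, hz, z2, e⟩ := h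
  exact ⟨z, hz, z2, by rw [e, ← mul_assoc, z2, one_mul]⟩

lemma SC.inv_left {x y : E} (h : SC x y) : SC x⁻¹ y := by
  obtain ⟨z, hz, z2, e⟩ := h
  refine ⟨z, hz, z2, ?_⟩
  have : y * x = z * (x * y) := by rw [e, ← mul_assoc, z2, one_mul]
  calc x⁻¹ * y = x⁻¹ * (y * x) * x⁻¹ := by group
    _ = _ := by rw [this, ← mul_assoc, ← hz]; group

lemma SC.pr_left {y : E} (a k : ℕ) (h : ∀ i, a ≤ i → i < a + k → SC (S i) y) : SC (pr S a k) y := by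
  induction k with
  | zero => exact ⟨1, by simp, by simp, by simp [pr_zero]⟩
  | succ k ih => rw [pr_succ]; exact (ih (fun i h1 h2 => h i h1 (by omega))).mul_left (h _ (by omega) (by omega))

lemma sc (h : CRel M S α β γ) (i j : ℕ) (h1 : i + 2 ≤ j) (h2 : j ≤ M + 1) : SC (S i) (S j) := by
  rcases Nat.lt_or_ge j (M+1) with h3 | h3
  · exact ⟨α, h.cα, h.α2, h.commA i j h1 (by omega)⟩
  · obtain rfl : j = M + 1 := by omega
    exact ⟨β, h.cβ, h.β2, h.commB i (by omega)⟩

lemma c_inv_step (h : CRel M S α β γ) (k : ℕ) (hk : k ≤ M + 2) :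
    ∃ g z : E, (∀ w, z * w = w * z) ∧ z * z = 1 ∧
      g * pr S 0 (M+2) * g⁻¹ = z * ((pr S 0 k)⁻¹ * pr S k (M+2-k)) := by
  induction k with
  | zero => exact ⟨1, 1, by simp, by simp, by simp [pr_zero]⟩
  | succ k ih =>
    obtain ⟨g, z, hz, z2, e⟩ := ih (by omega)
    have s : SC (pr S (k+1) (M+2-(k+1))) (pr S 0 k)⁻¹ := by
      apply SC.symm
      apply SC.inv_left
      apply SC.pr_left
      intro i _ hi
      apply SC.symm
      apply SC.pr_left
      intro j hj hj'
      exact (h.sc i j (by omega) (by omega)).symm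
    obtain ⟨z', hz', z2', e'⟩ := s
    refine ⟨pr S 0 k * g, z * z', ?_, ?_, ?_⟩
    · intro w; rw [mul_assoc, hz', ← mul_assoc, hz, mul_assoc]
    · rw [mul_assoc, ← mul_assoc z', hz' z, mul_assoc, z2', mul_one, z2]
    · have hsk : S k = (S k)⁻¹ := (inv_eq_of_mul_eq_one_left (h.sq k)).symm
      calc pr S 0 k * g * pr S 0 (M+2) * (pr S 0 k * g)⁻¹
          = pr S 0 k * (g * pr S 0 (M+2) * g⁻¹) * (pr S 0 k)⁻¹ := by group
        _ = z * (pr S k (M+2-k) * (pr S 0 k)⁻¹) := by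
          rw [e, ← mul_assoc, ← hz]; group
        _ = z * (S k * (pr S (k+1) (M+2-(k+1)) * (pr S 0 k)⁻¹)) := by
          rw [show M + 2 - k = (M+2-(k+1)) + 1 by omega, pr_succ_left]; simp only [mul_assoc]
        _ = z * z' * ((S k)⁻¹ * (pr S 0 k)⁻¹ * pr S (k+1) (M+2-(k+1))) := by
          rw [e', ← mul_assoc (S k), ← hz', ← hsk]; simp only [mul_assoc]
        _ = _ := by rw [pr_succ S 0 k, zero_add, mul_inv_rev]

lemma c_sq (h : CRel M S α β γ) (hM : Even M)
    (hc : ∀ x, pr S 0 (M+2) ^ (M+2) * x = x * pr S 0 (M+2) ^ (M+2)) :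
    pr S 0 (M+2) ^ (M+2) * pr S 0 (M+2) ^ (M+2) = 1 := by
  obtain ⟨g, z, hz, z2, e⟩ := h.c_inv_step (M+2) le_rfl
  rw [Nat.sub_self, pr_zero, mul_one] at e
  have e2 : (g * pr S 0 (M+2) * g⁻¹) ^ (M+2) = g * pr S 0 (M+2) ^ (M+2) * g⁻¹ := conj_pow
  rw [e, Commute.mul_pow (hz _), pow_even_one z2 (hM.add (by decide)), one_mul, ← hc,
    mul_inv_cancel_right, inv_pow] at e2
  nth_rewrite 1 [← e2]
  exact inv_mul_cancel _

end CRel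

/-- commutation up to a central element -/
def WC (x y : E) : Prop := ∃ z : E, (∀ w, z * w = w * z) ∧ x * y = z * (y * x)

lemma WC.symm {x y : E} (h : WC x y) : WC y x := by
  obtain ⟨z, hz, e⟩ := h
  refine ⟨z⁻¹, fun w => ?_, by rw [e]; group⟩
  have : Commute z w := hz w
  exact this.inv_left

/-- Conjugation-invariance of the commutator. -/
lemma wc_transfer {x x' y g : E} (hx : x' * g = g * x) (hg : WC g y) (z z' : E)
    (hz : ∀ w, z * w = w * z)
    (h : x * y = z * (y * x)) (h' : x' * y = z' * (y * x')) : z = z' := by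
  obtain ⟨v, hv, e⟩ := hg
  have e1 : x' * y * g = z' * (y * g * x) := by
    rw [h']; simp only [mul_assoc]; rw [hx]
  have e2 : v * (x' * y * g) = v * (z * (y * g * x)) := by
    calc v * (x' * y * g) = x' * (v * (y * g)) := by
          rw [← mul_assoc x', ← hv]; simp only [mul_assoc]
      _ = g * (x * y) := by rw [← e, ← mul_assoc, hx]; simp only [mul_assoc]
      _ = z * (g * y * x) := by rw [h, ← mul_assoc, ← hz]; simp only [mul_assoc]
      _ = _ := by
        rw [e, ← mul_assoc, ← mul_assoc, ← mul_assoc, ← mul_assoc, ← mul_assoc, ← mul_assoc, hz v]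
  have e3 := mul_left_cancel e2
  rw [e1] at e3
  exact (mul_right_cancel e3).symm

lemma wc_mul_left {x x' y : E} (h : WC x y) (h' : WC x' y) : WC (x * x') y := by
  obtain ⟨z, hz, e⟩ := h
  obtain ⟨z', hz', e'⟩ := h'
  refine ⟨z * z', ?_, ?_⟩
  · intro w; rw [mul_assoc, hz', ← mul_assoc, hz, mul_assoc]
  · rw [mul_assoc, e', ← mul_assoc, ← hz', mul_assoc, ← mul_assoc x, e, ← mul_assoc, ← mul_assoc,
      ← mul_assoc, hz' z]
    simp only [mul_assoc]

lemma sq_one_of_comm {x y z : E} (hx : x * x = 1) (hy : y * y = 1)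
    (hz : ∀ w, z * w = w * z) (h : x * y = z * (y * x)) : z * z = 1 := by
  have h1 : x * y * x * y = z := by
    calc x * y * x * y = (z * (y * x)) * (x * y) := by rw [← h]; simp only [mul_assoc]
      _ = z * (y * (x * x) * y) := by simp only [mul_assoc]
      _ = z := by rw [hx, mul_one, hy, mul_one]
  have h2 : y * x * y * x = z := by
    calc y * x * y * x = (x * x) * (y * x * y * x) := by rw [hx, one_mul]
      _ = x * (x * y * x * y) * x := by simp only [mul_assoc]
      _ = z := by rw [h1, ← hz, mul_assoc, hx, mul_one]
  calc z * z = (x * y * x * y) * (y * x * y * x) := by rw [h1, h2]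
    _ = x * y * x * (y * y) * x * y * x := by simp only [mul_assoc]
    _ = x * y * (x * x) * y * x := by rw [hy, mul_one]; simp only [mul_assoc]
    _ = x * (y * y) * x := by rw [hx, mul_one]; simp only [mul_assoc]
    _ = 1 := by rw [hy, mul_one, hx]

lemma crel_of_central {M : ℕ} (hM : Even M) (hM2 : 2 ≤ M) (S : ℕ → E)
    (sq : ∀ i, S i * S i = 1)
    (braid : ∀ i, i < M → S i * S (i+1) * S i = S (i+1) * S i * S (i+1))
    (comm : ∀ i j, i + 2 ≤ j → j ≤ M + 1 → WC (S i) (S j))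
    (four : ∀ w, (S M * S (M+1))^4 * w = w * (S M * S (M+1))^4)
    (hc : ∀ w, pr S 0 (M+2) ^ (M+2) * w = w * pr S 0 (M+2) ^ (M+2)) :
    CRel M S (S 0 * S 2 * S 0 * S 2) (S 0 * S (M+1) * S 0 * S (M+1)) 1 := by
  have cm : ∀ i j, i + 2 ≤ j → j ≤ M + 1 →
      S i * S j = (S i * S j * S i * S j) * (S j * S i) := by
    intro i j _ _
    rw [mul_assoc, mul_assoc, mul_assoc, ← mul_assoc (S j) (S j), sq, one_mul, sq, mul_one]
  have cen : ∀ i j, i + 2 ≤ j → j ≤ M + 1 →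
      ∀ w, (S i * S j * S i * S j) * w = w * (S i * S j * S i * S j) := by
    intro i j h1 h2
    obtain ⟨z, hz, e⟩ := comm i j h1 h2
    have : S i * S j * S i * S j = z := by
      have := cm i j h1 h2
      nth_rewrite 1 [e] at this
      exact (mul_right_cancel this).symm
    rw [this]; exact hz
  -- shifting the left index
  have shl : ∀ i j, i + 3 ≤ j → j ≤ M + 1 →
      S i * S j * S i * S j = S (i+1) * S j * S (i+1) * S j := by
    intro i j h1 h2
    refine wc_transfer (x := S i) (x' := S (i+1)) (y := S j) (g := S i * S (i+1)) ?_
      (wc_mul_left (comm _ _ (by omega) h2) (comm _ _ (by omega) h2)) _ _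
      (cen _ _ (by omega) h2) (cm _ _ (by omega) h2) (cm _ _ (by omega) h2)
    rw [braid i (by omega), mul_assoc]
  -- shifting the right index
  have shr : ∀ i j, i + 2 ≤ j → j < M →
      S i * S j * S i * S j = S i * S (j+1) * S i * S (j+1) := by
    intro i j h1 h2
    have key : (S i * S j * S i * S j)⁻¹ = (S i * S (j+1) * S i * S (j+1))⁻¹ := by
      have ci : ∀ i j, i + 2 ≤ j → j ≤ M + 1 →
          ∀ w, (S i * S j * S i * S j)⁻¹ * w = w * (S i * S j * S i * S j)⁻¹ := by
        intro i j h1 h2 w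
        have : Commute (S i * S j * S i * S j) w := cen i j h1 h2 w
        exact this.inv_left
      have cm' : ∀ i j, i + 2 ≤ j → j ≤ M + 1 →
          S j * S i = (S i * S j * S i * S j)⁻¹ * (S i * S j) := by
        intro i j h1 h2
        rw [eq_inv_mul_iff_mul_eq, ← cm i j h1 h2]
      refine wc_transfer (x := S j) (x' := S (j+1)) (y := S i) (g := S j * S (j+1)) ?_
        (wc_mul_left (comm _ _ (by omega) (by omega)).symm (comm _ _ (by omega) (by omega)).symm) _ _
        (ci _ _ (by omega) (by omega))
        (cm' _ _ (by omega) (by omega)) (cm' _ _ (by omega) (by omega))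
      rw [braid j (by omega), mul_assoc]
    exact inv_injective key
  have hB : ∀ i, i < M → S i * S (M+1) * S i * S (M+1) = S 0 * S (M+1) * S 0 * S (M+1) := by
    intro i
    induction i with
    | zero => intro _; rfl
    | succ i ih => intro hi; rw [← shl i (M+1) (by omega) (by omega), ih (by omega)]
  have hA0 : ∀ j, j + 2 ≤ M → S 0 * S (j+2) * S 0 * S (j+2) = S 0 * S 2 * S 0 * S 2 := by
    intro j
    induction j with
    | zero => intro _; rfl
    | succ j ih =>
      intro hj
      rw [show j + 1 + 2 = j + 2 + 1 by ring, ← shr 0 (j+2) (by omega) (by omega), ih (by omega)]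
  have hA : ∀ i j, i + 2 ≤ j → j ≤ M →
      S i * S j * S i * S j = S 0 * S 2 * S 0 * S 2 := by
    intro i
    induction i with
    | zero =>
      intro j h1 h2
      obtain ⟨l, rfl⟩ : ∃ l, j = l + 2 := ⟨j - 2, by omega⟩
      exact hA0 l h2
    | succ i ih => intro j h1 h2; rw [← shl i j (by omega) (by omega), ih j (by omega) h2]
  have main : CRel M S (S 0 * S 2 * S 0 * S 2) (S 0 * S (M+1) * S 0 * S (M+1))
      ((S M * S (M+1))^4) :=
    { cα := cen 0 2 (by omega) (by omega)
      cβ := cen 0 (M+1) (by omega) (by omega)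
      cγ := four
      α2 := sq_one_of_comm (sq 0) (sq 2) (cen 0 2 (by omega) (by omega)) (cm 0 2 (by omega) (by omega))
      β2 := sq_one_of_comm (sq 0) (sq (M+1)) (cen 0 (M+1) (by omega) (by omega))
        (cm 0 (M+1) (by omega) (by omega))
      sq := sq
      braid := braid
      commA := fun i j h1 h2 => by rw [← hA i j h1 h2]; exact cm i j h1 (by omega)
      commB := fun i h1 => by rw [← hB i h1]; exact cm i (M+1) (by omega) (by omega)
      four := rfl }
  have g1 : (S M * S (M+1))^4 = 1 := by
    have := main.c_all hM
    rw [hc] at this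
    exact (mul_eq_right.mp this.symm)
  rw [g1] at main
  exact main

lemma CRel.mapQ {M : ℕ} {S : ℕ → E} {α β γ : E} (h : CRel M S α β γ) {E' : Type*} [Group E']
    (f : E →* E') (hα : f α = 1) (hβ : f β = 1) (hγ : f γ = 1) :
    CRel M (fun i => f (S i)) 1 1 1 where
  cα := by simp
  cβ := by simp
  cγ := by simp
  α2 := by simp
  β2 := by simp
  sq := fun i => by rw [← map_mul, h.sq, map_one]
  braid := fun i hi => by simp only [← map_mul]; rw [h.braid i hi]
  commA := fun i j h1 h2 => by rw [← map_mul, h.commA i j h1 h2, map_mul, hα, map_mul]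
  commB := fun i h1 => by rw [← map_mul, h.commB i h1, map_mul, hβ, map_mul]
  four := by rw [← map_mul, ← map_pow, h.four, hγ]

end


section Ext

structure Coc (A Γ : Type*) [CommGroup A] [Group Γ] where
  f : Γ → Γ → A
  assoc : ∀ g h l, f g h * f (g * h) l = f h l * f g (h * l)
  one_left : ∀ g, f 1 g = 1
  one_right : ∀ g, f g 1 = 1

variable {A Γ : Type*} [CommGroup A] [Group Γ]

@[ext]
structure TwExt (c : Coc A Γ) where
  fst : A
  snd : Γ

namespace TwExt
variable (c : Coc A Γ)

instance : Mul (TwExt c) := ⟨fun x y => ⟨x.fst * y.fst * c.f x.snd y.snd, x.snd * y.snd⟩⟩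
instance : One (TwExt c) := ⟨⟨1, 1⟩⟩
instance : Inv (TwExt c) := ⟨fun x => ⟨x.fst⁻¹ * (c.f x.snd⁻¹ x.snd)⁻¹, x.snd⁻¹⟩⟩

instance : Group (TwExt c) :=
  Group.ofLeftAxioms
    (fun x y z => by
      apply TwExt.ext
      · change (x.fst * y.fst * c.f x.snd y.snd) * z.fst * c.f (x.snd * y.snd) z.snd =
          x.fst * (y.fst * z.fst * c.f y.snd z.snd) * c.f x.snd (y.snd * z.snd)
        have := c.assoc x.snd y.snd z.snd
        calc _ = x.fst * y.fst * z.fst * (c.f x.snd y.snd * c.f (x.snd * y.snd) z.snd) := by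
              simp only [mul_assoc, mul_left_comm]
          _ = _ := by rw [this]; simp only [mul_assoc]
      · exact mul_assoc x.snd y.snd z.snd)
    (fun x => by
      apply TwExt.ext
      · change 1 * x.fst * c.f 1 x.snd = x.fst
        rw [c.one_left, one_mul, mul_one]
      · exact one_mul x.snd)
    (fun x => by
      apply TwExt.ext
      · change x.fst⁻¹ * (c.f x.snd⁻¹ x.snd)⁻¹ * x.fst * c.f x.snd⁻¹ x.snd = 1
        rw [mul_right_comm x.fst⁻¹]; simp
      · exact inv_mul_cancel x.snd)

lemma mul_fst (x y : TwExt c) : (x * y).fst = x.fst * y.fst * c.f x.snd y.snd := rfl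
lemma mul_snd (x y : TwExt c) : (x * y).snd = x.snd * y.snd := rfl
lemma one_fst : (1 : TwExt c).fst = 1 := rfl
lemma one_snd : (1 : TwExt c).snd = 1 := rfl

def proj : TwExt c →* Γ where
  toFun := TwExt.snd
  map_one' := rfl
  map_mul' _ _ := rfl

def inc : A →* TwExt c where
  toFun a := ⟨a, 1⟩
  map_one' := rfl
  map_mul' a b := by
    apply TwExt.ext
    · rw [mul_fst]; simp [c.one_left]
    · rw [mul_snd]; simp

lemma inc_inj : Function.Injective (inc c) := fun _ _ h => congrArg TwExt.fst h

lemma inc_mul (a : A) (x : TwExt c) : inc c a * x = ⟨a * x.fst, x.snd⟩ := by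
  apply TwExt.ext
  · rw [mul_fst]; simp [inc, c.one_left]
  · rw [mul_snd]; simp [inc]

lemma inc_central (a : A) (x : TwExt c) : inc c a * x = x * inc c a := by
  rw [inc_mul]
  apply TwExt.ext
  · rw [mul_fst]; simp [inc, c.one_right, mul_comm]
  · rw [mul_snd]; simp [inc]

lemma exists_inc {x y : TwExt c} (h : x.snd = y.snd) : ∃ a, x = inc c a * y := by
  refine ⟨x.fst * y.fst⁻¹, ?_⟩
  rw [inc_mul]
  apply TwExt.ext <;> simp [h]

end TwExt

/-- The universal cocycle. -/
def univCoc (Γ : Type*) [Group Γ] : Coc (Z2 ℂ Γ →* ℂˣ) Γ where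
  f g h := { toFun := fun σ => σ.1 g h, map_one' := rfl, map_mul' := fun _ _ => rfl }
  assoc g h l := by ext σ; simp [σ.2.1 g h l]
  one_left g := by ext σ; simp [σ.2.2.1 g]
  one_right g := by ext σ; simp [σ.2.2.2 g]

def cocOf {Γ : Type*} [Group Γ] (σ : Z2 ℂ Γ) : Coc ℂˣ Γ where
  f := σ.1
  assoc := σ.2.1
  one_left := σ.2.2.1
  one_right := σ.2.2.2

noncomputable def fU (s : ℕ → Γ) : FreeGroup ℕ →* TwExt (univCoc Γ) := FreeGroup.lift (fun i => ⟨1, s i⟩)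

lemma fU_snd (s : ℕ → Γ) (w : FreeGroup ℕ) : (fU s w).snd = FreeGroup.lift s w := by
  have : (TwExt.proj (univCoc Γ)).comp (fU s) = FreeGroup.lift s := by
    ext i; simp [fU, TwExt.proj]
  exact DFunLike.congr_fun this w

noncomputable def ev (s : ℕ → Γ) (r : FreeGroup ℕ) : Z2 ℂ Γ →* ℂˣ := (fU s r).fst

/-- elements killed by the abelianization and by `s` -/
def Good (s : ℕ → Γ) (r : FreeGroup ℕ) : Prop :=
  FreeGroup.lift s r = 1 ∧ ∀ θ : FreeGroup ℕ →* ℂˣ, θ r = 1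

lemma master {Z P : Type*} [CommGroup Z] [Group P] (j : Z →* P) (hj : Function.Injective j)
    (hjc : ∀ z x, j z * x = x * j z) (χ : Z →* ℂˣ) (s : ℕ → Γ) (t : Γ → P) (ht1 : t 1 = 1)
    (b : Γ → Γ → Z) (hb : ∀ g h, t g * t h = j (b g h) * t (g * h))
    (σ : Z2 ℂ Γ) (hσ : ∀ g h, σ.1 g h = χ (b g h)) (q : FreeGroup ℕ →* P)
    (hq : ∀ i, ∃ z, q (FreeGroup.of i) = j z * t (s i))
    (r : FreeGroup ℕ) (hr : Good s r) (z : Z) (hz : q r = j z) : ev s r σ = χ z := by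
  have hmul : ∀ w w' y y', q w = j y * t (FreeGroup.lift s w) →
      q w' = j y' * t (FreeGroup.lift s w') →
      q (w * w') = j (y * y' * b (FreeGroup.lift s w) (FreeGroup.lift s w')) *
        t (FreeGroup.lift s (w * w')) := by
    intro w w' y y' h h'
    rw [map_mul, h, h', map_mul, map_mul, mul_assoc _ _ (t _), map_mul, ← hb]
    rw [mul_assoc, ← mul_assoc (t _) (j y'), ← hjc]
    simp only [mul_assoc]
  have hex : ∀ w, ∃ y, q w = j y * t (FreeGroup.lift s w) := by
    intro w
    induction w using FreeGroup.induction_on with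
    | C1 => exact ⟨1, by simp [ht1]⟩
    | of i => simpa using hq i
    | inv_of i _ =>
      obtain ⟨y, hy⟩ := hq i
      have := hb (s i)⁻¹ (s i)
      rw [inv_mul_cancel, ht1, mul_one] at this
      refine ⟨y⁻¹ * (b (s i)⁻¹ (s i))⁻¹, ?_⟩
      simp only [map_inv, FreeGroup.lift_apply_of]
      have e2 : t (s i) * t (s i)⁻¹ = j (b (s i)⁻¹ (s i)) := by
        have e3 : t (s i)⁻¹ = j (b (s i)⁻¹ (s i)) * (t (s i))⁻¹ := eq_mul_inv_of_mul_eq this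
        rw [e3, hjc, ← mul_assoc, mul_inv_cancel, one_mul]
      rw [hy, inv_eq_iff_mul_eq_one]
      calc j y * t (s i) * (j (y⁻¹ * (b (s i)⁻¹ (s i))⁻¹) * t (s i)⁻¹)
          = j y * j (y⁻¹ * (b (s i)⁻¹ (s i))⁻¹) * (t (s i) * t (s i)⁻¹) := by
            rw [mul_assoc, ← mul_assoc (t (s i)) (j _), ← hjc]; simp only [mul_assoc]
        _ = 1 := by rw [e2, ← map_mul, ← map_mul]; simp
    | mul w w' h h' =>
      obtain ⟨y, h⟩ := h
      obtain ⟨y', h'⟩ := h'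
      exact ⟨_, hmul w w' y y' h h'⟩
  choose y hy using hex
  have hymul : ∀ w w', y (w * w') = y w * y w' * b (FreeGroup.lift s w) (FreeGroup.lift s w') := by
    intro w w'
    have := hmul w w' _ _ (hy w) (hy w')
    rw [hy] at this
    exact hj (mul_right_cancel this)
  let θ : FreeGroup ℕ →* ℂˣ := MonoidHom.mk' (fun w => χ (y w) * (ev s w σ)⁻¹) (by
    intro w w'
    have : ev s (w * w') σ = ev s w σ * ev s w' σ *
        σ.1 (FreeGroup.lift s w) (FreeGroup.lift s w') := by
      unfold ev
      rw [map_mul, TwExt.mul_fst, ← fU_snd, ← fU_snd]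
      rfl
    rw [this, hymul, map_mul, map_mul, hσ]
    simp only [mul_inv, mul_assoc, mul_left_comm]
    simp)
  have h1 : χ (y r) * (ev s r σ)⁻¹ = 1 := hr.2 θ
  have h2 : y r = z := by
    apply hj
    rw [← hz, hy, hr.1, ht1, mul_one]
  rw [h2] at h1
  exact (mul_inv_eq_one.mp h1).symm

lemma ev_B2 (s : ℕ → Γ) (r : FreeGroup ℕ) (hr : Good s r) (σ : Z2 ℂ Γ) (h : σ ∈ B2 ℂ Γ) :
    ev s r σ = 1 := by
  obtain ⟨γ, h1, h2⟩ := h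
  have := master (Z := ℂˣ) (P := ℂˣ) (MonoidHom.id _) Function.injective_id
    (fun z x => mul_comm _ _) (MonoidHom.id _) s γ h1 (fun g h => σ.1 g h)
    (fun g h => by rw [h2]; simp) σ (fun _ _ => rfl) 1
    (fun i => ⟨(γ (s i))⁻¹, by simp⟩) r hr 1 (by simp)
  simpa using this

end Ext


lemma exists_char_ne {Z : Type*} [CommGroup Z] (e : Z) (he : e ≠ 1) : ∃ χ : Z →* ℂˣ, χ e ≠ 1 := by
  obtain ⟨c, hc⟩ := CharacterModule.exists_character_apply_ne_zero_of_ne_zero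
    (A := Additive Z) (a := Additive.ofMul e) (by simpa using he)
  let ex : ℚ →+ Additive ℂˣ := AddMonoidHom.mk'
    (fun q => Additive.ofMul (Units.mk0 (Complex.exp (2 * Real.pi * Complex.I * (q : ℂ)))
      (Complex.exp_ne_zero _))) (by
      intro a b
      rw [← ofMul_mul]
      congr 1
      ext
      simp [mul_add, Complex.exp_add])
  have hex : ∀ q, ex q = 0 ↔ q ∈ AddSubgroup.zmultiples (1 : ℚ) := by
    intro q
    have h1 : ex q = 0 ↔ Complex.exp (2 * Real.pi * Complex.I * (q : ℂ)) = 1 := by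
      constructor
      · intro h
        have h' : (Units.mk0 (Complex.exp (2 * Real.pi * Complex.I * (q : ℂ)))
          (Complex.exp_ne_zero _)) = 1 := h
        exact congrArg Units.val h'
      · intro h
        change (Units.mk0 (Complex.exp (2 * Real.pi * Complex.I * (q : ℂ)))
          (Complex.exp_ne_zero _)) = 1
        ext; exact h
    rw [h1, Complex.exp_eq_one_iff, AddSubgroup.mem_zmultiples_iff]
    have hne : (2 * Real.pi * Complex.I : ℂ) ≠ 0 := Complex.two_pi_I_ne_zero
    constructor
    · rintro ⟨n, hn⟩
      refine ⟨n, ?_⟩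
      rw [mul_comm] at hn
      have := mul_right_cancel₀ hne hn
      simp only [zsmul_eq_mul, mul_one]
      exact_mod_cast this.symm
    · rintro ⟨n, hn⟩
      refine ⟨n, ?_⟩
      rw [← hn]; push_cast [zsmul_eq_mul]; ring
  let ex' : AddCircle (1 : ℚ) →+ Additive ℂˣ :=
    QuotientAddGroup.lift (AddSubgroup.zmultiples (1 : ℚ)) ex (fun x hx => (hex x).2 hx)
  let cc : Additive Z →+ AddCircle (1 : ℚ) := c
  refine ⟨MonoidHom.mk' (fun z : Z => (ex' (cc (Additive.ofMul z))).toMul) ?_, ?_⟩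
  · intro x y; simp
  · intro h
    apply hc
    have h' : ex' (cc (Additive.ofMul e)) = 0 := h
    change cc (Additive.ofMul e) = 0
    obtain ⟨q, hq⟩ := QuotientAddGroup.mk_surjective (cc (Additive.ofMul e))
    rw [← hq] at h' ⊢
    exact (QuotientAddGroup.eq_zero_iff q).2 ((hex q).1 h')

structure Setup (M : ℕ) (Γ : Type) [Group Γ] (s : ℕ → Γ) : Prop where
  rel : CRel M s 1 1 1
  cN : pr s 0 (M+2) ^ (M+2) = 1
  triv : ∀ i, M + 2 ≤ i → s i = 1
  gen : Subgroup.closure (Set.range s) = ⊤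
  lift : ∀ (P : Type) [Group P] (S : ℕ → P), CRel M S 1 1 1 → pr S 0 (M+2) ^ (M+2) = 1 →
    ∃ φ : Γ →* P, ∀ i, i < M + 2 → φ (s i) = S i

def rA : FreeGroup ℕ :=
  FreeGroup.of 0 * FreeGroup.of 2 * (FreeGroup.of 0)⁻¹ * (FreeGroup.of 2)⁻¹
def rB (M : ℕ) : FreeGroup ℕ :=
  FreeGroup.of 0 * FreeGroup.of (M+1) * (FreeGroup.of 0)⁻¹ * (FreeGroup.of (M+1))⁻¹
def rC (M : ℕ) : FreeGroup ℕ :=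
  pr FreeGroup.of 0 (M+2) ^ (M+2) * (pr (fun i => FreeGroup.of i ^ (M+2)) 0 (M+2))⁻¹

section
variable {E : Type*} [Group E]

lemma lift_rA (S : ℕ → E) (sq : ∀ i, S i * S i = 1) :
    FreeGroup.lift S rA = S 0 * S 2 * S 0 * S 2 := by
  have : ∀ i, (S i)⁻¹ = S i := fun i => inv_eq_of_mul_eq_one_left (sq i)
  simp [rA, this]

lemma lift_rB (M : ℕ) (S : ℕ → E) (sq : ∀ i, S i * S i = 1) :
    FreeGroup.lift S (rB M) = S 0 * S (M+1) * S 0 * S (M+1) := by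
  have : ∀ i, (S i)⁻¹ = S i := fun i => inv_eq_of_mul_eq_one_left (sq i)
  simp [rB, this]

lemma lift_rC {M : ℕ} (hM : Even M) (S : ℕ → E) (sq : ∀ i, S i * S i = 1) :
    FreeGroup.lift S (rC M) = pr S 0 (M+2) ^ (M+2) := by
  have h1 : ∀ i, (S i) ^ (M+2) = 1 := fun i => pow_even_one (sq i) (hM.add (by decide))
  have h2 : ∀ k, pr (fun _ => (1 : E)) 0 k = 1 := fun k => by simp [pr]
  rw [rC, map_mul, map_pow, map_inv, map_pr, map_pr]
  simp [h1, h2]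

lemma kill_rA (θ : FreeGroup ℕ →* ℂˣ) : θ rA = 1 := by
  simp only [rA, map_mul, map_inv]; rw [mul_right_comm]; simp

lemma kill_rB (M : ℕ) (θ : FreeGroup ℕ →* ℂˣ) : θ (rB M) = 1 := by
  simp only [rB, map_mul, map_inv]; rw [mul_right_comm]; simp

lemma kill_rC (M : ℕ) (θ : FreeGroup ℕ →* ℂˣ) : θ (rC M) = 1 := by
  rw [rC, map_mul, map_pow, map_inv, map_pr, map_pr, mul_inv_eq_one]
  simp only [map_pow]
  generalize M + 2 = n
  have : ∀ k, pr (fun i => θ (FreeGroup.of i)) 0 k ^ n = pr (fun i => θ (FreeGroup.of i) ^ n) 0 k := by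
    intro k
    induction k with
    | zero => simp [pr_zero]
    | succ k ih => rw [pr_succ, pr_succ, mul_pow, ih]
  exact this _

lemma comm_val {x y z : E} (hx : x * x = 1) (hy : y * y = 1)
    (h : x * y = z * (y * x)) : x * y * x * y = z := by
  calc x * y * x * y = (z * (y * x)) * (x * y) := by rw [← h]; simp only [mul_assoc]
    _ = z * (y * (x * x) * y) := by simp only [mul_assoc]
    _ = z := by rw [hx, mul_one, hy, mul_one]

lemma CRel.alpha_eq {M : ℕ} {S : ℕ → E} {α β γ : E} (h : CRel M S α β γ) (hM2 : 2 ≤ M) :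
    S 0 * S 2 * S 0 * S 2 = α :=
  comm_val (h.sq _) (h.sq _) (h.commA 0 2 (by omega) hM2)

lemma CRel.beta_eq {M : ℕ} {S : ℕ → E} {α β γ : E} (h : CRel M S α β γ) (hM2 : 2 ≤ M) :
    S 0 * S (M+1) * S 0 * S (M+1) = β :=
  comm_val (h.sq _) (h.sq _) (h.commB 0 (by omega))

end

section
variable {M : ℕ} {Γ : Type} [Group Γ] {s : ℕ → Γ}

lemma Setup.goodA (hS : Setup M Γ s) (hM2 : 2 ≤ M) : Good s rA :=
  ⟨by rw [lift_rA s hS.rel.sq, hS.rel.alpha_eq hM2], kill_rA⟩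

lemma Setup.goodB (hS : Setup M Γ s) (hM2 : 2 ≤ M) : Good s (rB M) :=
  ⟨by rw [lift_rB M s hS.rel.sq, hS.rel.beta_eq hM2], kill_rB M⟩

lemma Setup.goodC (hS : Setup M Γ s) (hM : Even M) : Good s (rC M) :=
  ⟨by rw [lift_rC hM s hS.rel.sq, hS.cN], kill_rC M⟩

lemma exists_unit_sqrt (a : ℂˣ) : ∃ x : ℂˣ, x * x = a := by
  obtain ⟨y, hy⟩ := IsAlgClosed.exists_pow_nat_eq (a : ℂ) (n := 2) (by norm_num)
  have hy0 : y ≠ 0 := by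
    rintro rfl
    exact a.ne_zero (by rw [← hy]; simp)
  exact ⟨Units.mk0 y hy0, by ext; simp [← hy, pow_two]⟩

open TwExt in
/-- Normalised lifts of the generators in the central extension attached to `σ`. -/
lemma Setup.lifts (hS : Setup M Γ s) (σ : Z2 ℂ Γ) :
    ∃ S : ℕ → TwExt (cocOf σ), (∀ i, (S i).snd = s i) ∧ (∀ i, S i * S i = 1) ∧
      (∀ i, i < M → S i * S (i+1) * S i = S (i+1) * S i * S (i+1)) := by
  set c := cocOf σ
  have h1 : ∀ i, ∃ e : TwExt c, e.snd = s i ∧ e * e = 1 := by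
    intro i
    obtain ⟨a, ha⟩ := exists_inc c (x := (⟨1, s i⟩ : TwExt c) * ⟨1, s i⟩) (y := 1)
      (by rw [mul_snd, one_snd]; exact hS.rel.sq i)
    obtain ⟨x, hx⟩ := exists_unit_sqrt a⁻¹
    refine ⟨inc c x * ⟨1, s i⟩, ?_, ?_⟩
    · rw [inc_mul]
    · rw [mul_assoc, ← mul_assoc _ (inc c x), ← inc_central, mul_assoc (inc c x), ha,
        ← mul_assoc, ← map_mul, hx, mul_one, ← map_mul, inv_mul_cancel, map_one]
  choose T hT hT2 using h1
  have h2 : ∀ i, ∃ a : ℂˣ, i < M → T i * T (i+1) * T i = inc c a * (T (i+1) * T i * T (i+1)) := by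
    intro i
    by_cases hi : i < M
    · obtain ⟨a, ha⟩ := exists_inc c (x := T i * T (i+1) * T i) (y := T (i+1) * T i * T (i+1))
        (by simp only [mul_snd, hT]; exact hS.rel.braid i hi)
      exact ⟨a, fun _ => ha⟩
    · exact ⟨1, fun h => absurd h hi⟩
  choose a ha using h2
  have ha2 : ∀ i, i < M → a i * a i = 1 := by
    intro i hi
    apply inc_inj c
    have e1 : (T i * T (i+1) * T i) * (T i * T (i+1) * T i) = 1 := by
      calc _ = T i * T (i+1) * (T i * T i) * T (i+1) * T i := by simp only [mul_assoc]
        _ = T i * (T (i+1) * T (i+1)) * T i := by rw [hT2, mul_one]; simp only [mul_assoc]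
        _ = 1 := by rw [hT2, mul_one, hT2]
    have e2 : (T (i+1) * T i * T (i+1)) * (T (i+1) * T i * T (i+1)) = 1 := by
      calc _ = T (i+1) * T i * (T (i+1) * T (i+1)) * T i * T (i+1) := by simp only [mul_assoc]
        _ = T (i+1) * (T i * T i) * T (i+1) := by rw [hT2, mul_one]; simp only [mul_assoc]
        _ = 1 := by rw [hT2, mul_one, hT2]
    rw [ha i hi, mul_assoc, ← mul_assoc _ (inc c (a i)), ← inc_central, mul_assoc (inc c (a i)),
      e2, mul_one] at e1
    rw [map_mul, e1, map_one]
  let d : ℕ → ℂˣ := fun i => ∏ l ∈ Finset.range i, (if l < M then a l else 1)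
  have hd : ∀ i, d i * d i = 1 := by
    intro i
    simp only [d, ← Finset.prod_mul_distrib]
    apply Finset.prod_eq_one
    intro l _
    split_ifs with h
    · exact ha2 l h
    · simp
  have hd' : ∀ i, i < M → d (i+1) = d i * a i := by
    intro i hi
    simp only [d, Finset.prod_range_succ, if_pos hi]
  have mv : ∀ (x y z : ℂˣ) (A B C : TwExt c),
      inc c x * A * (inc c y * B) * (inc c z * C) = inc c (x * y * z) * (A * B * C) := by
    intro x y z A B C
    rw [mul_assoc, mul_assoc, mul_assoc (inc c y), ← mul_assoc B, ← inc_central c z B, ← mul_assoc A,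
      ← inc_central c y A]
    rw [mul_assoc (inc c z), mul_assoc (inc c y), ← mul_assoc A (inc c z), ← inc_central c z A,
      map_mul, map_mul]
    simp only [mul_assoc]
  refine ⟨fun i => inc c (d i) * T i, ?_, ?_, ?_⟩
  · intro i; simp only [inc_mul]; exact hT i
  · intro i
    simp only
    rw [mul_assoc, ← mul_assoc _ (inc c (d i)), ← inc_central, mul_assoc (inc c (d i)), hT2, mul_one,
      ← map_mul, hd, map_one]
  · intro i hi
    simp only
    rw [mv, mv, ha i hi, ← mul_assoc, ← map_mul, hd' i hi]
    congr 2
    have e1 := hd i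
    have e2 := ha2 i hi
    calc d i * (d i * a i) * d i * a i = (d i * d i) * d i * (a i * a i) := by
          simp only [mul_assoc, mul_left_comm, mul_comm]
      _ = (d i * d i) * d i * (a i * a i) := rfl
      _ = _ := by simp only [mul_assoc, mul_left_comm, mul_comm]

open TwExt in
lemma Setup.main (hS : Setup M Γ s) (hM : Even M) (hM2 : 2 ≤ M) (σ : Z2 ℂ Γ) :
    ∃ S : ℕ → TwExt (cocOf σ), (∀ i, (S i).snd = s i) ∧
      CRel M S (inc _ (ev s rA σ)) (inc _ (ev s (rB M) σ)) 1 ∧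
      pr S 0 (M+2) ^ (M+2) = inc _ (ev s (rC M) σ) := by
  obtain ⟨S, h1, sq, braid⟩ := hS.lifts σ
  let c := cocOf σ
  have cen : ∀ x : TwExt c, x.snd = 1 → ∃ a, x = inc c a := by
    intro x hx
    obtain ⟨a, ha⟩ := exists_inc c (x := x) (y := 1) (by rw [hx, one_snd])
    exact ⟨a, by rw [ha, mul_one]⟩
  have cen' : ∀ x : TwExt c, x.snd = 1 → ∀ w, x * w = w * x := by
    intro x hx
    obtain ⟨a, rfl⟩ := cen x hx
    exact inc_central c a
  have sndpr : ∀ k, (pr S 0 k).snd = pr s 0 k := by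
    intro k
    have := map_pr (proj c) S 0 k
    simp only [proj, MonoidHom.coe_mk, OneHom.coe_mk, h1] at this
    exact this
  have sndpow : ∀ (x : TwExt c) (k : ℕ), (x ^ k).snd = x.snd ^ k := fun x k => map_pow (proj c) x k
  have hC : (pr S 0 (M+2) ^ (M+2)).snd = 1 := by rw [sndpow, sndpr, hS.cN]
  have rel := crel_of_central hM hM2 S sq braid (fun i j h2 h3 => by
      have : (S i * S j).snd = (S j * S i).snd := by
        rw [mul_snd, mul_snd, h1, h1]
        rcases Nat.lt_or_ge j (M+1) with h4 | h4
        · have := hS.rel.commA i j h2 (by omega); rwa [one_mul] at this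
        · obtain rfl : j = M + 1 := by omega
          have := hS.rel.commB i (by omega); rwa [one_mul] at this
      obtain ⟨a, ha⟩ := exists_inc c this
      exact ⟨inc c a, inc_central c a, ha⟩)
    (cen' _ (by rw [sndpow, mul_snd, h1, h1, hS.rel.four])) (cen' _ hC)
  have heval : ∀ r, Good s r → FreeGroup.lift S r = inc c (ev s r σ) := by
    intro r hr
    have hsnd : (FreeGroup.lift S r).snd = 1 := by
      have : (proj c).comp (FreeGroup.lift S) = FreeGroup.lift s := by
        ext i; simp [proj, h1]
      rw [← hr.1, ← this]; rfl
    obtain ⟨a, ha⟩ := cen _ hsnd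
    have := master (Z := ℂˣ) (P := TwExt c) (inc c) (inc_inj c) (inc_central c) (MonoidHom.id _) s
      (fun g => ⟨1, g⟩) rfl (fun g h => σ.1 g h)
      (fun g h => by
        rw [inc_mul]
        apply TwExt.ext
        · rw [mul_fst]; simp [c, cocOf]
        · rw [mul_snd]) σ (fun _ _ => rfl) (FreeGroup.lift S)
      (fun i => by
        obtain ⟨a, ha⟩ := exists_inc c (x := S i) (y := ⟨1, s i⟩) (h1 i)
        exact ⟨a, by rw [FreeGroup.lift_apply_of, ha]⟩) r hr a ha
    rw [ha, this]; rfl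
  refine ⟨S, h1, ?_, ?_⟩
  · rw [← heval _ (hS.goodA hM2), ← heval _ (hS.goodB hM2), lift_rA S sq, lift_rB M S sq]
    exact rel
  · rw [← heval _ (hS.goodC hM), lift_rC hM S sq]

open TwExt in
lemma Setup.sq_one (hS : Setup M Γ s) (hM : Even M) (hM2 : 2 ≤ M) (σ : Z2 ℂ Γ) :
    ev s rA σ ^ 2 = 1 ∧ ev s (rB M) σ ^ 2 = 1 ∧ ev s (rC M) σ ^ 2 = 1 := by
  obtain ⟨S, h1, rel, hc⟩ := hS.main hM hM2 σ
  refine ⟨?_, ?_, ?_⟩ <;> apply inc_inj (cocOf σ) <;> rw [pow_two, map_mul, map_one]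
  · exact rel.α2
  · exact rel.β2
  · rw [← hc]
    apply rel.c_sq hM
    rw [hc]
    exact inc_central _ _

open TwExt in
lemma Setup.inj (hS : Setup M Γ s) (hM : Even M) (hM2 : 2 ≤ M) (σ : Z2 ℂ Γ)
    (hA : ev s rA σ = 1) (hB : ev s (rB M) σ = 1) (hC : ev s (rC M) σ = 1) : σ ∈ B2 ℂ Γ := by
  obtain ⟨S, h1, rel, hc⟩ := hS.main hM hM2 σ
  rw [hA, hB, map_one] at rel
  rw [hC, map_one] at hc
  obtain ⟨φ, hφ⟩ := hS.lift _ S rel hc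
  have hsec : ∀ g, (φ g).snd = g := by
    have : (proj (cocOf σ)).comp φ = MonoidHom.id Γ := by
      apply MonoidHom.eq_of_eqOn_dense hS.gen
      rintro _ ⟨i, rfl⟩
      rcases Nat.lt_or_ge i (M+2) with hi | hi
      · simp [hφ i hi, proj, h1]
      · simp [hS.triv i hi]
    exact fun g => DFunLike.congr_fun this g
  refine ⟨fun g => ((φ g).fst)⁻¹, by simp [one_fst], fun g h => ?_⟩
  have := congrArg TwExt.fst (map_mul φ g h)
  rw [mul_fst, hsec, hsec] at this
  change σ.1 g h = _
  simp only
  rw [this]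
  simp only [cocOf]
  rw [inv_inv, ← mul_inv, inv_mul_cancel_left]

end


section
variable {M : ℕ} {Γ : Type} [Group Γ] {s : ℕ → Γ}

lemma Setup.lower0 (hS : Setup M Γ s) {P : Type} [Group P] {p : ℕ → P} {α β : P}
    (h : CRel M p α β 1) (hp : ∀ i, M + 2 ≤ i → p i = 1)
    (hc : ∀ x, pr p 0 (M+2) ^ (M+2) * x = x * pr p 0 (M+2) ^ (M+2))
    (χ : Subgroup.center P →* ℂˣ) :
    ∃ σ : Z2 ℂ Γ, ∀ r, Good s r → ∀ z : Subgroup.center P, FreeGroup.lift p r = z →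
      ev s r σ = χ z := by
  letI : CommGroup (Subgroup.center P) :=
    { (inferInstance : Group (Subgroup.center P)) with
      mul_comm := fun a b => Subtype.ext (Subgroup.mem_center_iff.1 b.2 a) }
  have mem : ∀ x : P, (∀ y, x * y = y * x) → QuotientGroup.mk' (Subgroup.center P) x = 1 := by
    intro x hx
    rw [QuotientGroup.mk'_apply, QuotientGroup.eq_one_iff, Subgroup.mem_center_iff]
    exact fun g => (hx g).symm
  have hQ := h.mapQ (QuotientGroup.mk' (Subgroup.center P)) (mem _ h.cα) (mem _ h.cβ) (map_one _)
  obtain ⟨ρ, hρ⟩ := hS.lift _ _ hQ (by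
    rw [← map_pr, ← map_pow]; exact mem _ hc)
  have hρ' : ∀ i, ρ (s i) = QuotientGroup.mk' (Subgroup.center P) (p i) := by
    intro i
    rcases Nat.lt_or_ge i (M+2) with hi | hi
    · exact hρ i hi
    · rw [hS.triv i hi, hp i hi, map_one, map_one]
  have hex : ∀ g : Γ, ∃ t : P, QuotientGroup.mk' (Subgroup.center P) t = ρ g ∧ (g = 1 → t = 1) := by
    intro g
    by_cases hg : g = 1
    · exact ⟨1, by rw [hg, map_one, map_one], fun _ => rfl⟩
    · obtain ⟨t, ht⟩ := QuotientGroup.mk'_surjective (Subgroup.center P) (ρ g)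
      exact ⟨t, ht, fun h => absurd h hg⟩
  choose t ht ht1 using hex
  have ker : ∀ x y : P, QuotientGroup.mk' (Subgroup.center P) x =
      QuotientGroup.mk' (Subgroup.center P) y → ∃ z : Subgroup.center P, x = z * y := by
    intro x y hxy
    refine ⟨⟨x * y⁻¹, ?_⟩, by simp⟩
    rw [← QuotientGroup.eq_one_iff, ← QuotientGroup.mk'_apply, map_mul, map_inv, hxy,
      mul_inv_cancel]
  have hb : ∀ g h, ∃ z : Subgroup.center P, t g * t h = z * t (g * h) := by
    intro g h
    apply ker
    rw [map_mul, ht, ht, ht, map_mul]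
  choose b hb using hb
  have cen : ∀ (z : Subgroup.center P) (x : P), (z : P) * x = x * z := by
    intro z x
    exact (Subgroup.mem_center_iff.1 z.2 x).symm
  have t1 : t 1 = 1 := ht1 1 rfl
  have coc : ∀ g h l, b g h * b (g * h) l = b h l * b g (h * l) := by
    intro g h l
    apply Subtype.ext
    have e1 : t g * t h * t l = ((b g h * b (g*h) l : Subgroup.center P) : P) * t (g * h * l) := by
      rw [hb, mul_assoc, hb, Subgroup.coe_mul, mul_assoc ((b g h : P))]
    have e2 : t g * t h * t l = ((b h l * b g (h*l) : Subgroup.center P) : P) * t (g * h * l) := by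
      rw [mul_assoc, hb, ← mul_assoc, ← cen, mul_assoc, hb, Subgroup.coe_mul, mul_assoc, mul_assoc]
    exact mul_right_cancel (e1.symm.trans e2)
  have b1 : ∀ g, b 1 g = 1 := by
    intro g
    apply Subtype.ext
    have := hb 1 g
    rw [t1, one_mul, one_mul] at this
    exact (mul_eq_right.1 this.symm)
  have b2 : ∀ g, b g 1 = 1 := by
    intro g
    apply Subtype.ext
    have := hb g 1
    rw [t1, mul_one, mul_one] at this
    exact (mul_eq_right.1 this.symm)
  refine ⟨⟨fun g h => χ (b g h), ⟨fun g h l => ?_, fun g => ?_, fun g => ?_⟩⟩, ?_⟩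
  · rw [← map_mul, coc, map_mul]
  · change χ (b 1 g) = 1
    rw [b1, map_one]
  · change χ (b g 1) = 1
    rw [b2, map_one]
  · intro r hr z hz
    refine master (Subgroup.center P).subtype Subtype.val_injective cen χ s t t1 b hb _
      (fun _ _ => rfl) (FreeGroup.lift p) (fun i => ?_) r hr z hz
    obtain ⟨z, hz⟩ := ker (p i) (t (s i)) (by rw [ht, hρ'])
    exact ⟨z, by rw [FreeGroup.lift_apply_of, hz]; rfl⟩

lemma Setup.lower (hS : Setup M Γ s) (hM : Even M) (hM2 : 2 ≤ M) {P : Type} [Group P]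
    {p : ℕ → P} {α β : P}
    (h : CRel M p α β 1) (hp : ∀ i, M + 2 ≤ i → p i = 1) (e : P) (he : e ≠ 1)
    (he' : e = α ∨ e = β ∨ e = pr p 0 (M+2) ^ (M+2)) :
    ∃ f : P → ℂˣ, f 1 = 1 ∧ f e ≠ 1 ∧ ∃ σ, ev s rA σ = f α ∧ ev s (rB M) σ = f β ∧
      ev s (rC M) σ = f (pr p 0 (M+2) ^ (M+2)) := by
  classical
  let K := Subgroup.closure (Set.range p)
  let q : ℕ → K := fun i => ⟨p i, Subgroup.subset_closure ⟨i, rfl⟩⟩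
  let α' : K := q 0 * q 2 * q 0 * q 2
  let β' : K := q 0 * q (M+1) * q 0 * q (M+1)
  have hα : (α' : P) = α := h.alpha_eq hM2
  have hβ : (β' : P) = β := h.beta_eq hM2
  have hq : CRel M q α' β' 1 := by
    refine ⟨?_, ?_, ?_, ?_, ?_, ?_, ?_, ?_, ?_, ?_⟩
    · intro x; apply Subtype.ext; change (α' : P) * x = x * α'; rw [hα]; exact h.cα x
    · intro x; apply Subtype.ext; change (β' : P) * x = x * β'; rw [hβ]; exact h.cβ x
    · intro x; simp
    · apply Subtype.ext; change (α' : P) * α' = 1; rw [hα]; exact h.α2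
    · apply Subtype.ext; change (β' : P) * β' = 1; rw [hβ]; exact h.β2
    · intro i; apply Subtype.ext; exact h.sq i
    · intro i hi; apply Subtype.ext; exact h.braid i hi
    · intro i j h1 h2; apply Subtype.ext
      change p i * p j = α' * (p j * p i); rw [hα]; exact h.commA i j h1 h2
    · intro i hi; apply Subtype.ext
      change p i * p (M+1) = β' * (p (M+1) * p i); rw [hβ]; exact h.commB i hi
    · apply Subtype.ext; exact h.four
  have hpc : ((pr q 0 (M+2) ^ (M+2) : K) : P) = pr p 0 (M+2) ^ (M+2) := by
    have := map_pr K.subtype q 0 (M+2)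
    rw [Subgroup.coe_pow]
    exact congrArg (· ^ (M+2)) this
  have hqt : ∀ i, M + 2 ≤ i → q i = 1 := fun i hi => Subtype.ext (hp i hi)
  have hqc : ∀ x : K, pr q 0 (M+2) ^ (M+2) * x = x * pr q 0 (M+2) ^ (M+2) := by
    rintro ⟨x, hx⟩
    apply Subtype.ext
    rw [Subgroup.coe_mul, Subgroup.coe_mul, hpc]
    have : K ≤ Subgroup.centralizer {pr p 0 (M+2) ^ (M+2)} := by
      rw [Subgroup.closure_le]
      rintro _ ⟨i, rfl⟩
      rw [SetLike.mem_coe, Subgroup.mem_centralizer_singleton_iff]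
      rcases Nat.lt_or_ge i (M+2) with hi | hi
      · exact ((h.c_central hM i hi).eq).symm
      · rw [hp i hi]; simp
    exact (Subgroup.mem_centralizer_singleton_iff.1 (this hx)).symm
  have mem : ∀ x : K, (∀ y, x * y = y * x) → x ∈ Subgroup.center K := by
    intro x hx
    rw [Subgroup.mem_center_iff]
    exact fun g => (hx g).symm
  have heK : ∃ z : Subgroup.center K, ((z : K) : P) = e := by
    rcases he' with rfl | rfl | rfl
    · exact ⟨⟨α', mem _ hq.cα⟩, hα⟩
    · exact ⟨⟨β', mem _ hq.cβ⟩, hβ⟩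
    · exact ⟨⟨_, mem _ hqc⟩, hpc⟩
  obtain ⟨z, hz⟩ := heK
  letI : CommGroup (Subgroup.center K) :=
    { (inferInstance : Group (Subgroup.center K)) with
      mul_comm := fun a b => Subtype.ext (Subgroup.mem_center_iff.1 b.2 a) }
  obtain ⟨χ, hχ⟩ := exists_char_ne z (fun h => he (by rw [← hz, h]; rfl))
  obtain ⟨σ, hσ⟩ := hS.lower0 hq hqt hqc χ
  let f : P → ℂˣ := fun x => if hx : ∃ z : Subgroup.center K, ((z : K) : P) = x then χ hx.choose else 1
  have hf : ∀ z : Subgroup.center K, f ((z : K) : P) = χ z := by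
    intro z
    have hx : ∃ z' : Subgroup.center K, ((z' : K) : P) = ((z : K) : P) := ⟨z, rfl⟩
    simp only [f]
    rw [dif_pos hx]
    congr 1
    exact Subtype.ext (Subtype.ext hx.choose_spec)
  refine ⟨f, ?_, ?_, σ, ?_, ?_, ?_⟩
  · have := hf 1
    rw [map_one] at this; exact this
  · rw [← hz, hf]; exact hχ
  · have := hf ⟨α', mem _ hq.cα⟩
    rw [← hα, this]
    exact hσ _ (hS.goodA hM2) _ (lift_rA q hq.sq)
  · have := hf ⟨β', mem _ hq.cβ⟩
    rw [← hβ, this]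
    exact hσ _ (hS.goodB hM2) _ (lift_rB M q hq.sq)
  · have := hf ⟨_, mem _ hqc⟩
    rw [← hpc, this]
    exact hσ _ (hS.goodC hM) _ (lift_rC hM q hq.sq)

end


section Models

/-! Model 1: signed permutations -/

def fB (M i : ℕ) (x : ℕ × Bool) : ℕ × Bool :=
  if i ≤ M then (if x.1 = i then i + 1 else if x.1 = i + 1 then i else x.1, x.2)
  else if i = M + 1 then (x.1, if x.1 = M + 1 then !x.2 else x.2) else x

lemma fB_inv (M i : ℕ) (x : ℕ × Bool) : fB M i (fB M i x) = x := by
  obtain ⟨k, b⟩ := x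
  by_cases h1 : i ≤ M
  · simp only [fB, h1, if_true]; grind
  · by_cases h2 : i = M + 1
    · subst h2
      by_cases h3 : k = M + 1 <;> simp [fB, h3]
    · simp [fB, h1, h2]

def pB (M i : ℕ) : Equiv.Perm (ℕ × Bool) := Function.Involutive.toPerm (fB M i) (fB_inv M i)

lemma pB_apply (M i : ℕ) (x : ℕ × Bool) : pB M i x = fB M i x := rfl

lemma pB_low (M i k : ℕ) (b : Bool) (h : i ≤ M) :
    pB M i (k, b) = (if k = i then i + 1 else if k = i + 1 then i else k, b) := by
  simp [pB_apply, fB, h]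

lemma pB_top (M k : ℕ) (b : Bool) :
    pB M (M+1) (k, b) = (k, if k = M + 1 then !b else b) := by
  simp [pB_apply, fB]

lemma pB_rel (M : ℕ) : CRel M (pB M) 1 1 1 where
  cα _ := by simp
  cβ _ := by simp
  cγ _ := by simp
  α2 := by simp
  β2 := by simp
  sq i := by
    apply Equiv.ext; intro x
    exact fB_inv M i x
  braid i hi := by
    apply Equiv.ext; rintro ⟨k, b⟩
    simp only [Equiv.Perm.mul_apply, pB_low M i _ _ hi.le, pB_low M (i+1) _ _ hi, Prod.mk.injEq,
      and_true]
    split_ifs <;> omega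
  commA i j h1 h2 := by
    apply Equiv.ext; rintro ⟨k, b⟩
    rw [one_mul]
    simp only [Equiv.Perm.mul_apply, pB_low M i _ _ (by omega : i ≤ M), pB_low M j _ _ h2,
      Prod.mk.injEq, and_true]
    split_ifs <;> omega
  commB i h := by
    apply Equiv.ext; rintro ⟨k, b⟩
    rw [one_mul]
    simp only [Equiv.Perm.mul_apply, pB_low M i _ _ h.le, pB_top, Prod.mk.injEq]
    refine ⟨trivial, ?_⟩
    split_ifs <;> first | omega | rfl
  four := by
    apply Equiv.ext; rintro ⟨k, b⟩
    have e0 : ∀ b, (pB M M * pB M (M+1)) (M, b) = (M+1, b) := by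
      intro b
      simp [Equiv.Perm.mul_apply, pB_top, pB_low M M _ _ le_rfl]
    have e1 : ∀ b, (pB M M * pB M (M+1)) (M+1, b) = (M, !b) := by
      intro b
      simp [Equiv.Perm.mul_apply, pB_top, pB_low M M _ _ le_rfl]
    have e2 : ∀ b, k ≠ M → k ≠ M + 1 → (pB M M * pB M (M+1)) (k, b) = (k, b) := by
      intro b h1 h2
      simp [Equiv.Perm.mul_apply, pB_top, pB_low M M _ _ le_rfl, h1, h2]
    generalize pB M M * pB M (M+1) = c at *
    rw [pow_succ, pow_succ, pow_two, Equiv.Perm.mul_apply, Equiv.Perm.mul_apply,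
      Equiv.Perm.mul_apply, Equiv.Perm.one_apply]
    by_cases h1 : k = M
    · rw [h1, e0, e1, e0, e1, Bool.not_not]
    · by_cases h2 : k = M + 1
      · rw [h2, e1, e0, e1, e0, Bool.not_not]
      · rw [e2 _ h1 h2, e2 _ h1 h2, e2 _ h1 h2, e2 _ h1 h2]

lemma pB_triv (M i : ℕ) (h : M + 2 ≤ i) : pB M i = 1 := by
  apply Equiv.ext; intro x
  simp only [pB_apply, fB, Equiv.Perm.one_apply]
  rw [if_neg (by omega), if_neg (by omega)]

lemma pB_pr (M j k : ℕ) (b : Bool) (h : j ≤ M + 1) :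
    pr (pB M) 0 j (k, b) = (if k < j then k + 1 else if k = j then 0 else k, b) := by
  induction j generalizing k with
  | zero => simp [pr_zero]
  | succ j ih =>
    rw [pr_succ, Equiv.Perm.mul_apply, zero_add, pB_low M j _ _ (by omega), ih _ (by omega)]
    simp only [Prod.mk.injEq, and_true]
    split_ifs <;> omega

lemma pB_c_ne (M : ℕ) : pr (pB M) 0 (M+2) ^ (M+2) ≠ 1 := by
  intro h
  have e : ∀ k b, pr (pB M) 0 (M+2) (k, b) =
      (if k < M+1 then k + 1 else if k = M+1 then 0 else k, if k = M + 1 then !b else b) := by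
    intro k b
    rw [pr_succ, Equiv.Perm.mul_apply, zero_add, pB_top, pB_pr _ _ _ _ le_rfl]
  have e2 : ∀ j, j ≤ M + 1 → (pr (pB M) 0 (M+2) ^ j) (0, true) = (j, true) := by
    intro j
    induction j with
    | zero => intro _; simp
    | succ j ih =>
      intro hj
      rw [pow_succ', Equiv.Perm.mul_apply, ih (by omega), e]
      rw [if_pos (by omega), if_neg (by omega)]
  have e3 := DFunLike.congr_fun h (0, true)
  rw [pow_succ', Equiv.Perm.mul_apply, e2 _ le_rfl, e] at e3
  simp at e3

/-! Model 2: dihedral group of order 8 -/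

def pD (M i : ℕ) : DihedralGroup 4 :=
  if i ≤ M then DihedralGroup.sr 0 else if i = M + 1 then DihedralGroup.sr 1 else 1

lemma pD_low (M i : ℕ) (h : i ≤ M) : pD M i = DihedralGroup.sr 0 := by simp [pD, h]
lemma pD_top (M : ℕ) : pD M (M+1) = DihedralGroup.sr 1 := by simp [pD]
lemma pD_triv (M i : ℕ) (h : M + 2 ≤ i) : pD M i = 1 := by
  rw [pD, if_neg (by omega), if_neg (by omega)]

lemma pD_rel (M : ℕ) : CRel M (pD M) 1 (DihedralGroup.r 2) 1 where
  cα _ := by simp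
  cβ := by decide
  cγ _ := by simp
  α2 := by simp
  β2 := by decide
  sq i := by unfold pD; split_ifs <;> decide
  braid i hi := by rw [pD_low M i hi.le, pD_low M (i+1) hi]
  commA i j h1 h2 := by rw [pD_low M i (by omega), pD_low M j h2, one_mul]
  commB i h := by rw [pD_low M i h.le, pD_top]; decide
  four := by rw [pD_low M M le_rfl, pD_top]; decide

/-! Model 3: Clifford algebra -/

def matA (n : ℕ) : Matrix (Fin n) (Fin n) ℚ := fun i j =>
  if i = j then 1 else if i.val + 1 = j.val then -1 else 0

noncomputable def QA (n : ℕ) : QuadraticForm ℚ (Fin n → ℚ) :=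
  LinearMap.BilinMap.toQuadraticMap (Matrix.toBilin' (matA n))

lemma QA_single (n : ℕ) (i : Fin n) : QA n (Pi.single i 1) = 1 := by
  rw [QA, LinearMap.BilinMap.toQuadraticMap_apply, Matrix.toBilin'_single]
  simp [matA]

lemma QA_polar (n : ℕ) (i j : Fin n) : QuadraticMap.polar (QA n) (Pi.single i 1) (Pi.single j 1)
    = matA n i j + matA n j i := by
  rw [QA, LinearMap.BilinMap.polar_toQuadraticMap, Matrix.toBilin'_single, Matrix.toBilin'_single]

noncomputable def vA (n : ℕ) (i : Fin n) : CliffordAlgebra (QA n) :=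
  CliffordAlgebra.ι (QA n) (Pi.single i 1)

lemma vA_sq (n : ℕ) (i : Fin n) : vA n i * vA n i = 1 := by
  rw [vA, CliffordAlgebra.ι_sq_scalar, QA_single, map_one]

lemma vA_swap (n : ℕ) (i j : Fin n) : vA n i * vA n j + vA n j * vA n i =
    algebraMap ℚ _ (matA n i j + matA n j i) := by
  rw [vA, vA, CliffordAlgebra.ι_mul_ι_add_swap, QA_polar]

noncomputable def pA (M i : ℕ) : (CliffordAlgebra (QA (M+1)))ˣ :=
  if h : i < M + 1 then ⟨vA _ ⟨i, h⟩, vA _ ⟨i, h⟩, vA_sq _ _, vA_sq _ _⟩ else 1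

lemma pA_low (M i : ℕ) (h : i < M + 1) : (pA M i : CliffordAlgebra (QA (M+1))) = vA _ ⟨i, h⟩ := by
  simp [pA, h]

lemma pA_triv (M i : ℕ) (h : M + 1 ≤ i) : pA M i = 1 := by
  rw [pA, dif_neg (by omega)]

lemma pA_sq (M i : ℕ) : pA M i * pA M i = 1 := by
  by_cases h : i < M + 1
  · apply Units.ext
    rw [Units.val_mul, pA_low M i h, vA_sq, Units.val_one]
  · rw [pA_triv M i (by omega), one_mul]

lemma pA_neg_ne (M : ℕ) : (-1 : (CliffordAlgebra (QA (M+1)))ˣ) ≠ 1 := by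
  intro h
  have h1 : (-1 : CliffordAlgebra (QA (M+1))) = 1 := by
    have := congrArg Units.val h
    simpa using this
  have h2 : algebraMap ℚ (CliffordAlgebra (QA (M+1))) (-1) = algebraMap ℚ _ 1 := by
    rw [map_neg, map_one, h1]
  have := (algebraMap ℚ (CliffordAlgebra (QA (M+1)))).injective h2
  norm_num at this

lemma pA_rel (M : ℕ) : CRel M (pA M) (-1) 1 1 where
  cα _ := by simp
  cβ _ := by simp
  cγ _ := by simp
  α2 := by simp
  β2 := by simp
  sq i := pA_sq M i
  braid i hi := by
    have e := vA_swap (M+1) ⟨i, by omega⟩ ⟨i+1, by omega⟩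
    have e1 := vA_sq (M+1) ⟨i, by omega⟩
    have e2 := vA_sq (M+1) ⟨i+1, by omega⟩
    apply Units.ext
    rw [Units.val_mul, Units.val_mul, Units.val_mul, Units.val_mul, pA_low M i (by omega),
      pA_low M (i+1) (by omega)]
    have e0 : matA (M+1) ⟨i, by omega⟩ ⟨i+1, by omega⟩ + matA (M+1) ⟨i+1, by omega⟩ ⟨i, by omega⟩
      = -1 := by
      simp [matA]; omega
    rw [e0, map_neg, map_one] at e
    generalize vA (M+1) ⟨i, _⟩ = x at *
    generalize vA (M+1) ⟨i+1, _⟩ = y at *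
    have h1 : x * y = -1 - y * x := eq_sub_of_add_eq e
    have h2 : x * y * x = -x - y := by
      rw [h1, sub_mul, mul_assoc, e1]; simp
    have h3 : y * x * y = -x - y := by
      rw [mul_assoc, h1, mul_sub, ← mul_assoc, e2]; simp; abel
    rw [h2, h3]
  commA i j h1 h2 := by
    have e := vA_swap (M+1) ⟨i, by omega⟩ ⟨j, by omega⟩
    apply Units.ext
    rw [Units.val_mul, Units.val_mul, Units.val_mul, pA_low M i (by omega),
      pA_low M j (by omega)]
    have e0 : matA (M+1) ⟨i, by omega⟩ ⟨j, by omega⟩ + matA (M+1) ⟨j, by omega⟩ ⟨i, by omega⟩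
      = 0 := by
      simp only [matA, Fin.mk.injEq]
      rw [if_neg (by omega), if_neg (by omega), if_neg (by omega), if_neg (by omega), add_zero]
    rw [e0, map_zero] at e
    rw [eq_neg_of_add_eq_zero_left e]
    simp
  commB i h := by rw [pA_triv M (M+1) le_rfl]; simp
  four := by
    rw [pA_triv M (M+1) le_rfl, mul_one, show 4 = 2 * 2 from rfl, pow_mul, pow_two (pA M M), pA_sq, one_pow]

end Models


section Final

variable {M : ℕ} {Γ : Type} [Group Γ] {s : ℕ → Γ}

lemma unit_neg_one_of {x : ℂˣ} (h : x ^ 2 = 1) (h1 : x ≠ 1) : x = -1 := by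
  have e : ((x : ℂ)) ^ 2 = 1 := by rw [← Units.val_pow_eq_pow_val, h, Units.val_one]
  rcases (by simpa using e : (x : ℂ) = 1 ∨ (x : ℂ) = -1) with h2 | h2
  · exact absurd (Units.ext h2) h1
  · apply Units.ext; simpa using h2

lemma Setup.surj (hS : Setup M Γ s) (hM : Even M) (hM2 : 2 ≤ M) (a b c : ℂˣ)
    (ha : a ^ 2 = 1) (hb : b ^ 2 = 1) (hc : c ^ 2 = 1) :
    ∃ σ : Z2 ℂ Γ, ev s rA σ = a ∧ ev s (rB M) σ = b ∧ ev s (rC M) σ = c := by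
  have hC : ∀ c : ℂˣ, c ^ 2 = 1 →
      ∃ σ : Z2 ℂ Γ, ev s rA σ = 1 ∧ ev s (rB M) σ = 1 ∧ ev s (rC M) σ = c := by
    intro c hc
    by_cases h1 : c = 1
    · exact ⟨1, by simp [h1]⟩
    · obtain ⟨f, hf, hfe, σ, h2, h3, h4⟩ := hS.lower hM hM2 (pB_rel M) (pB_triv M) _ (pB_c_ne M)
        (Or.inr (Or.inr rfl))
      refine ⟨σ, by rw [h2, hf], by rw [h3, hf], ?_⟩
      rw [← h4] at hfe
      rw [unit_neg_one_of hc h1, unit_neg_one_of (hS.sq_one hM hM2 σ).2.2 hfe]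
  have hB : ∃ σ : Z2 ℂ Γ, ev s rA σ = 1 ∧ ev s (rB M) σ = b := by
    by_cases h1 : b = 1
    · exact ⟨1, by simp [h1]⟩
    · obtain ⟨f, hf, hfe, σ, h2, h3, h4⟩ := hS.lower hM hM2 (pD_rel M) (pD_triv M)
        (DihedralGroup.r 2) (by decide) (Or.inr (Or.inl rfl))
      refine ⟨σ, by rw [h2, hf], ?_⟩
      rw [← h3] at hfe
      rw [unit_neg_one_of hb h1, unit_neg_one_of (hS.sq_one hM hM2 σ).2.1 hfe]
  have hA : ∃ σ : Z2 ℂ Γ, ev s rA σ = a ∧ ev s (rB M) σ = 1 := by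
    by_cases h1 : a = 1
    · exact ⟨1, by simp [h1]⟩
    · obtain ⟨f, hf, hfe, σ, h2, h3, h4⟩ := hS.lower hM hM2 (pA_rel M)
        (fun i hi => pA_triv M i (by omega)) (-1) (pA_neg_ne M) (Or.inl rfl)
      refine ⟨σ, ?_, by rw [h3, hf]⟩
      rw [← h2] at hfe
      rw [unit_neg_one_of ha h1, unit_neg_one_of (hS.sq_one hM hM2 σ).1 hfe]
  obtain ⟨σ, h1, h2⟩ := hA
  obtain ⟨τ, h3, h4⟩ := hB
  obtain ⟨ρ, h5, h6, h7⟩ := hC (c * (ev s (rC M) (σ * τ))⁻¹) (by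
    rw [mul_pow, inv_pow, (hS.sq_one hM hM2 (σ * τ)).2.2, hc, inv_one, one_mul])
  refine ⟨ρ * (σ * τ), ?_, ?_, ?_⟩
  · simp [h1, h3, h5]
  · simp [h2, h4, h6]
  · rw [map_mul, h7, inv_mul_cancel_right]

lemma Setup.final (hS : Setup M Γ s) (hM : Even M) (hM2 : 2 ≤ M) :
    Nonempty (H2 ℂ Γ ≃* Multiplicative (ZMod 2 × ZMod 2 × ZMod 2)) := by
  let A : Z2 ℂ Γ →* rootsOfUnity 2 ℂ := (ev s rA).codRestrict _ (fun σ => by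
    rw [mem_rootsOfUnity]; exact (hS.sq_one hM hM2 σ).1)
  let B : Z2 ℂ Γ →* rootsOfUnity 2 ℂ := (ev s (rB M)).codRestrict _ (fun σ => by
    rw [mem_rootsOfUnity]; exact (hS.sq_one hM hM2 σ).2.1)
  let C : Z2 ℂ Γ →* rootsOfUnity 2 ℂ := (ev s (rC M)).codRestrict _ (fun σ => by
    rw [mem_rootsOfUnity]; exact (hS.sq_one hM hM2 σ).2.2)
  let Φ := A.prod (B.prod C)
  have hsurj : Function.Surjective Φ := by
    rintro ⟨⟨a, ha⟩, ⟨b, hb⟩, ⟨c, hc⟩⟩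
    rw [mem_rootsOfUnity] at ha hb hc
    obtain ⟨σ, h1, h2, h3⟩ := hS.surj hM hM2 a b c ha hb hc
    exact ⟨σ, Prod.ext (Subtype.ext h1) (Prod.ext (Subtype.ext h2) (Subtype.ext h3))⟩
  have hker : B2 ℂ Γ = Φ.ker := by
    ext σ
    rw [MonoidHom.mem_ker]
    constructor
    · intro h
      exact Prod.ext (Subtype.ext (ev_B2 s _ (hS.goodA hM2) σ h))
        (Prod.ext (Subtype.ext (ev_B2 s _ (hS.goodB hM2) σ h))
          (Subtype.ext (ev_B2 s _ (hS.goodC hM) σ h)))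
    · intro h
      have h1 := congrArg (fun x => (x.1 : ℂˣ)) h
      have h2 := congrArg (fun x => (x.2.1 : ℂˣ)) h
      have h3 := congrArg (fun x => (x.2.2 : ℂˣ)) h
      exact hS.inj hM hM2 σ h1 h2 h3
  have e1 : H2 ℂ Γ ≃* (Z2 ℂ Γ ⧸ Φ.ker) := QuotientGroup.quotientMulEquivOfEq hker
  have e2 := QuotientGroup.quotientKerEquivOfSurjective Φ hsurj
  have e3 : rootsOfUnity 2 ℂ ≃* Multiplicative (ZMod 2) := by
    have h1 : Nat.card (rootsOfUnity 2 ℂ) = 2 := by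
      rw [Complex.card_rootsOfUnity]
    have h2 : Nat.card (Multiplicative (ZMod 2)) = 2 := by simp
    have : Fact (Nat.Prime 2) := ⟨Nat.prime_two⟩
    exact mulEquivOfPrimeCardEq h1 h2
  have e4 : Multiplicative (ZMod 2 × ZMod 2 × ZMod 2) ≃*
      Multiplicative (ZMod 2) × Multiplicative (ZMod 2) × Multiplicative (ZMod 2) :=
    (MulEquiv.prodMultiplicative _ _).trans ((MulEquiv.refl _).prodCongr
      (MulEquiv.prodMultiplicative _ _))
  exact ⟨e1.trans (e2.trans ((e3.prodCongr (e3.prodCongr e3)).trans e4.symm))⟩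

end Final


section Cox

lemma cox_rel {n : ℕ} (μ : Fin n → Fin n → ℕ) (i j : Fin n) :
    (coxS μ i * coxS μ j) ^ μ i j = 1 := by
  have h : (FreeGroup.of i * FreeGroup.of j) ^ μ i j ∈ coxeterRels μ := by
    simp only [coxeterRels, Set.mem_iUnion]
    exact ⟨i, j, rfl⟩
  have := PresentedGroup.one_of_mem h
  rw [map_pow, map_mul] at this
  exact this

lemma pow_swap_one {E : Type*} [Group E] {x y : E} (hx : x * x = 1) (hy : y * y = 1) (e : ℕ)
    (h : (x * y) ^ e = 1) : (y * x) ^ e = 1 := by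
  have : y * x = (x * y)⁻¹ := by
    rw [mul_inv_rev, inv_eq_of_mul_eq_one_left hx, inv_eq_of_mul_eq_one_left hy]
  rw [this, inv_pow, h, inv_one]

lemma braid_iff {E : Type*} [Group E] {x y : E} (hx : x * x = 1) (hy : y * y = 1) :
    (x * y) ^ 3 = 1 ↔ x * y * x = y * x * y := by
  have h1 : (y * x * y)⁻¹ = y * x * y := by
    rw [mul_inv_rev, mul_inv_rev, inv_eq_of_mul_eq_one_left hx, inv_eq_of_mul_eq_one_left hy,
      mul_assoc]
  have h2 : (x * y) ^ 3 = (x * y * x) * (y * x * y) := by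
    rw [pow_succ, pow_two]; simp only [mul_assoc]
  rw [h2, mul_eq_one_iff_eq_inv, h1]

lemma comm_iff {E : Type*} [Group E] {x y : E} (hx : x * x = 1) (hy : y * y = 1) :
    (x * y) ^ 2 = 1 ↔ x * y = y * x := by
  have h1 : (x * y)⁻¹ = y * x := by
    rw [mul_inv_rev, inv_eq_of_mul_eq_one_left hx, inv_eq_of_mul_eq_one_left hy]
  rw [pow_two, mul_eq_one_iff_eq_inv, h1]

lemma pr_ofFn {E : Type*} [Group E] (n : ℕ) (S : ℕ → E) (f : Fin n → E) (h : ∀ i, f i = S i) :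
    (List.ofFn f).prod = pr S 0 n := by
  have : f = fun i : Fin n => S i := funext h
  subst this
  rw [pr, ← List.range_eq_range', List.ofFn_eq_map, List.map_coe_finRange_eq_range.symm, List.map_map]
  rfl

/-- relators of type B hold -/
lemma CRel.mB_rel {M : ℕ} {E : Type*} [Group E] {S : ℕ → E} (h : CRel M S 1 1 1)
    (i j : Fin (M+2)) : (S i * S j) ^ mB (M+2) i j = 1 := by
  have lt : ∀ i j : Fin (M+2), i < j → (S i * S j) ^ mB (M+2) i j = 1 := by
    intro i j hij
    have hij' : i.val < j.val := hij
    unfold mB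
    rw [if_neg hij.ne]
    split_ifs with h1 h2
    · obtain h3 : j.val = M + 1 := by omega
      obtain h4 : i.val = M := by omega
      rw [h3, h4]; exact h.four
    · rw [braid_iff (h.sq _) (h.sq _)]
      have h3 : j.val = i.val + 1 := by omega
      rw [h3]; exact h.braid _ (by omega)
    · rw [comm_iff (h.sq _) (h.sq _)]
      by_cases h3 : j.val = M + 1
      · rw [h3]
        have := h.commB i.val (by omega)
        rwa [one_mul] at this
      · have := h.commA i.val j.val (by omega) (by omega)
        rwa [one_mul] at this
  rcases lt_trichotomy i j with hij | hij | hij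
  · exact lt i j hij
  · subst hij; simp [mB, h.sq]
  · have e : mB (M+2) i j = mB (M+2) j i := by
      unfold mB
      rw [if_neg hij.ne', if_neg hij.ne]
      split_ifs <;> omega
    rw [e]
    exact pow_swap_one (h.sq _) (h.sq _) _ (lt j i hij)

def wB (M : ℕ) (i : ℕ) : CoxGroup (mB (M+2)) := if h : i < M + 2 then coxS _ ⟨i, h⟩ else 1

lemma wB_low (M i : ℕ) (h : i < M + 2) : wB M i = coxS _ ⟨i, h⟩ := by simp [wB, h]

lemma wB_rel (M : ℕ) : CRel M (wB M) 1 1 1 := by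
  have sq : ∀ i, wB M i * wB M i = 1 := by
    intro i
    by_cases h : i < M + 2
    · have := cox_rel (mB (M+2)) ⟨i, h⟩ ⟨i, h⟩
      rw [wB_low M i h]
      simpa [mB] using this
    · simp [wB, h]
  refine ⟨by simp, by simp, by simp, by simp, by simp, sq, ?_, ?_, ?_, ?_⟩
  · intro i hi
    rw [← braid_iff (sq _) (sq _)]
    have := cox_rel (mB (M+2)) ⟨i, by omega⟩ ⟨i+1, by omega⟩
    rw [wB_low M i (by omega), wB_low M (i+1) (by omega)]
    have e : mB (M+2) ⟨i, by omega⟩ ⟨i+1, by omega⟩ = 3 := by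
      simp [mB]; omega
    rwa [e] at this
  · intro i j h1 h2
    rw [one_mul, ← comm_iff (sq _) (sq _)]
    have := cox_rel (mB (M+2)) ⟨i, by omega⟩ ⟨j, by omega⟩
    rw [wB_low M i (by omega), wB_low M j (by omega)]
    have e : mB (M+2) ⟨i, by omega⟩ ⟨j, by omega⟩ = 2 := by
      simp only [mB, Fin.mk.injEq]
      rw [if_neg (by omega), if_neg (by omega)]
    rwa [e] at this
  · intro i h1
    rw [one_mul, ← comm_iff (sq _) (sq _)]
    have := cox_rel (mB (M+2)) ⟨i, by omega⟩ ⟨M+1, by omega⟩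
    rw [wB_low M i (by omega), wB_low M (M+1) (by omega)]
    have e : mB (M+2) ⟨i, by omega⟩ ⟨M+1, by omega⟩ = 2 := by
      simp only [mB, Fin.mk.injEq]
      rw [if_neg (by omega), if_neg (by omega)]
    rwa [e] at this
  · have := cox_rel (mB (M+2)) ⟨M, by omega⟩ ⟨M+1, by omega⟩
    rw [wB_low M M (by omega), wB_low M (M+1) (by omega)]
    have e : mB (M+2) ⟨M, by omega⟩ ⟨M+1, by omega⟩ = 4 := by
      simp [mB]; omega
    rwa [e] at this

lemma setup_cox (M : ℕ) (u : CoxGroup (mB (M+2))) (hu : u = coxProd (mB (M+2)) ^ (M+2))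
    [hn : (Subgroup.zpowers u).Normal] :
    Setup M (CoxGroup (mB (M+2)) ⧸ Subgroup.zpowers u)
      (fun i => QuotientGroup.mk' (Subgroup.zpowers u) (wB M i)) := by
  have hprod : coxProd (mB (M+2)) = pr (wB M) 0 (M+2) :=
    pr_ofFn _ _ _ (fun i => (wB_low M i i.2).symm)
  refine ⟨(wB_rel M).mapQ _ (map_one _) (map_one _) (map_one _), ?_, ?_, ?_, ?_⟩
  · rw [← map_pr, ← map_pow, ← hprod, ← hu, QuotientGroup.mk'_apply, QuotientGroup.eq_one_iff]
    exact Subgroup.mem_zpowers u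
  · intro i hi
    rw [wB, dif_neg (by omega), map_one]
  · have h1 : Subgroup.closure (Set.range (wB M)) = ⊤ := by
      rw [eq_top_iff, ← PresentedGroup.closure_range_of (coxeterRels (mB (M+2)))]
      apply Subgroup.closure_mono
      rintro _ ⟨i, rfl⟩
      exact ⟨i, wB_low M i i.2⟩
    have h2 : Set.range (fun i => QuotientGroup.mk' (Subgroup.zpowers u) (wB M i)) =
        QuotientGroup.mk' (Subgroup.zpowers u) '' Set.range (wB M) := by
      rw [← Set.range_comp]; rfl
    rw [h2, ← MonoidHom.map_closure, h1, ← MonoidHom.range_eq_map, MonoidHom.range_eq_top]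
    exact QuotientGroup.mk'_surjective _
  · intro P _ S hS hc
    have hrel : ∀ r ∈ coxeterRels (mB (M+2)),
        FreeGroup.lift (fun i : Fin (M+2) => S i) r = 1 := by
      intro r hr
      simp only [coxeterRels, Set.mem_iUnion, Set.mem_singleton_iff] at hr
      obtain ⟨i, j, rfl⟩ := hr
      rw [map_pow, map_mul, FreeGroup.lift_apply_of, FreeGroup.lift_apply_of]
      exact hS.mB_rel i j
    let ψ : CoxGroup (mB (M+2)) →* P := PresentedGroup.toGroup hrel
    have hψ : ∀ i, i < M + 2 → ψ (wB M i) = S i := by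
      intro i hi
      rw [wB_low M i hi]
      exact PresentedGroup.toGroup.of hrel
    have hψu : ψ u = 1 := by
      rw [hu, hprod, map_pow, map_pr, ← hc]
      congr 1
      exact pr_congr _ _ _ _ fun i _ h2 => hψ i (by omega)
    refine ⟨QuotientGroup.lift (Subgroup.zpowers u) ψ ?_, ?_⟩
    · intro x hx
      obtain ⟨e, rfl⟩ := Subgroup.mem_zpowers_iff.1 hx
      rw [MonoidHom.mem_ker, map_zpow, hψu, one_zpow]
    · intro i hi
      exact hψ i hi

lemma final_cox (n M : ℕ) (hnM : n = M + 2) (hM : Even M) (hM2 : 2 ≤ M)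
    (u : CoxGroup (mB n)) (hu : u = coxProd (mB n) ^ n) [hn : (Subgroup.zpowers u).Normal] :
    Nonempty (H2 ℂ (CoxGroup (mB n) ⧸ Subgroup.zpowers u) ≃*
      Multiplicative (ZMod 2 × ZMod 2 × ZMod 2)) := by
  subst hnM
  exact (setup_cox M u hu).final hM hM2

end Cox

theorem statement13 (m : ℕ) (hm : 2 ≤ m)
    (u : CoxGroup (mB (2 * m))) (hu : u = coxProd (mB (2 * m)) ^ (2 * m))
    (hcen : ∀ w, u * w = w * u) (h2 : u ^ 2 = 1)
    [hn : (Subgroup.zpowers u).Normal] :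
    Nonempty (H2 ℂ (CoxGroup (mB (2 * m)) ⧸ Subgroup.zpowers u) ≃*
      Multiplicative (ZMod 2 × ZMod 2 × ZMod 2)) := by
  exact final_cox (2 * m) (2 * (m - 1)) (by omega) (even_two_mul _) (by omega) u hu
end
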